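/- arXiv:1701.08115 — 4 statements merged into one kernel-verified Lean document; each statement's English description precedes it below -/
import Mathlib

section
/- Let 3 ≤ k ≤ s be integers and let A and B be disjoint finite vertex sets. Suppose that the k-graph H₀^k(A,B) contains a copy C of the tight cycle C_s^k with V(C) ∩ A ≠ ∅, and let d = gcd(k,s). Then |V(C) ∩ A| ≡ 0 (mod s/d), and the pair (k,s) is not admissible (that is, d ≥ 2 and k/d is odd). -/
set_option autoImplicit false

open Finset

section Defs

variable {V : Type} [Fintype V] [DecidableEq V]

/-- `E` is the edge set of a `k`-uniform hypergraph on `V`. -/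
def IsKGraph (k : ℕ) (E : Finset (Finset V)) : Prop := ∀ e ∈ E, e.card = k

/-- The degree of a vertex set `S`: the number of edges containing `S`. -/
def degS (E : Finset (Finset V)) (S : Finset V) : ℕ := (E.filter fun e => S ⊆ e).card

/-- `C` is the (cyclically ordered) vertex list of a copy of a tight cycle:
the vertices are distinct and every `k` cyclically consecutive vertices form an edge. -/
def IsTightCycleList (k : ℕ) (E : Finset (Finset V)) (C : List V) : Prop :=
  C.Nodup ∧ ∀ i < C.length, (((C ++ C).drop i).take k).toFinset ∈ E

/-- `H` has a `C_s^k`-covering: every vertex lies in a copy of the tight cycle on `s` vertices. -/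
def HasCsCovering (k s : ℕ) (E : Finset (Finset V)) : Prop :=
  ∀ v : V, ∃ C : List V, C.length = s ∧ IsTightCycleList k E C ∧ v ∈ C

/-- `H` contains a copy of `C_s^k`. -/
def HasCsCopy (k s : ℕ) (E : Finset (Finset V)) : Prop :=
  ∃ C : List V, C.length = s ∧ IsTightCycleList k E C

/-- `A` is the vertex set of a copy of `C_s^k` in `H`. -/
def SpansCs (k s : ℕ) (E : Finset (Finset V)) (A : Finset V) : Prop :=
  ∃ C : List V, C.length = s ∧ IsTightCycleList k E C ∧ C.toFinset = A

/-- a `C_s^k`-tiling: a set of pairwise disjoint vertex sets of copies of `C_s^k`. -/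
def IsCsTiling (k s : ℕ) (E : Finset (Finset V)) (T : Finset (Finset V)) : Prop :=
  (T : Set (Finset V)).PairwiseDisjoint id ∧ ∀ A ∈ T, SpansCs k s E A

/-- a perfect `C_s^k`-tiling of the induced subgraph on `U`. -/
def HasPerfectCsTilingOn (k s : ℕ) (E : Finset (Finset V)) (U : Finset V) : Prop :=
  ∃ T : Finset (Finset V), IsCsTiling k s E T ∧ T.biUnion id = U

/-- a perfect `C_s^k`-tiling of `H`. -/
def HasPerfectCsTiling (k s : ℕ) (E : Finset (Finset V)) : Prop :=
  HasPerfectCsTilingOn k s E Finset.univ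

/-- the pair `(k,s)` is admissible if `gcd k s = 1` or `k / gcd k s` is even. -/
def AdmissiblePair (k s : ℕ) : Prop := Nat.gcd k s = 1 ∨ Even (k / Nat.gcd k s)

/-- The `k`-graph `H₀^k(A,B)`: edges are the `k`-subsets `e` of `A ∪ B`
with `|e ∩ A| ≢ k (mod 2)`. -/
def H0edges (k : ℕ) (A B : Finset V) : Finset (Finset V) :=
  ((A ∪ B).powersetCard k).filter fun e => ¬ (e ∩ A).card % 2 = k % 2

/-- `P` is (the vertex list of) a tight path: distinct vertices, every `k`
consecutive vertices form an edge. -/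
def IsTightPath (k : ℕ) (E : Finset (Finset V)) (P : List V) : Prop :=
  P.Nodup ∧ ∀ i, i + k ≤ P.length → ((P.drop i).take k).toFinset ∈ E

/-- `P = v₁ ⋯ v_ℓ` has start of type `σ` w.r.t. classes `Vc`: `v_i ∈ V_{σ(i)}`
for `1 ≤ i ≤ k-1` (0-indexed below). -/
def hasStartType (k : ℕ) (Vc : Fin k → Finset V) (P : List V) (σ : Equiv.Perm (Fin k)) : Prop :=
  k ≤ P.length + 1 ∧ ∀ j : Fin k, (j : ℕ) + 1 < k → ∀ v ∈ P[(j : ℕ)]?, v ∈ Vc (σ j)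

/-- `P = v₁ ⋯ v_ℓ` has end of type `σ` w.r.t. classes `Vc`: `v_{ℓ-k+i} ∈ V_{σ(i)}`
for `2 ≤ i ≤ k` (0-indexed below). -/
def hasEndType (k : ℕ) (Vc : Fin k → Finset V) (P : List V) (σ : Equiv.Perm (Fin k)) : Prop :=
  k ≤ P.length + 1 ∧ ∀ j : Fin k, (j : ℕ) ≠ 0 →
    ∀ v ∈ P[(P.length + (j : ℕ) - k)]?, v ∈ Vc (σ j)

/-- `Vc` are the classes of a complete `(k,k)`-graph in `H`: nonempty, pairwise disjoint,
and every transversal is an edge. -/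
def IsCompletePartite (k : ℕ) (E : Finset (Finset V)) (Vc : Fin k → Finset V) : Prop :=
  (∀ i, (Vc i).Nonempty) ∧ (∀ i j, i ≠ j → Disjoint (Vc i) (Vc j)) ∧
  ∀ g : Fin k → V, (∀ i, g i ∈ Vc i) → Finset.image g Finset.univ ∈ E

/-- the cyclic permutation `τ = (1 2 ⋯ k)` (0-indexed: `j ↦ j + 1 mod k`). -/
def cyc (k : ℕ) : Equiv.Perm (Fin k) := finRotate k

/-- `W` is a `G`-gadget for the complete `(k,k)`-graph with classes `Vc` avoiding `S`. -/
def IsGadget (k : ℕ) (E : Finset (Finset V)) (Vc : Fin k → Finset V)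
    (G : SimpleGraph (Fin k)) (S : Finset V) (W : Fin k → Fin k → Finset V) : Prop :=
  (∀ i j, G.Adj i j → W i j = W j i) ∧
  (∀ i j, G.Adj i j →
    (W i j).card = 2 * k - 1 ∧
    (W i j \ Finset.univ.biUnion Vc).card = 1 ∧
    Disjoint (W i j) S ∧
    (∀ i' : Fin k, (W i j ∩ Vc i').card = if i' = i ∨ i' = j then 1 else 2) ∧
    (∀ σ : Equiv.Perm (Fin k), (∃ z : Fin k, (z : ℕ) = 0 ∧ (σ z = i ∨ σ z = j)) →
      ∃ Q : List V, IsTightPath k E Q ∧ Q.toFinset = W i j ∧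
        hasStartType k Vc Q (σ * cyc k) ∧ hasEndType k Vc Q (Equiv.swap i j * σ))) ∧
  (∀ i j i' j', G.Adj i j → G.Adj i' j' → ({i, j} : Finset (Fin k)) ≠ {i', j'} →
    Disjoint (W i j) (W i' j'))

open Classical in
/-- the set of vertices `w_{ij}`, `ij ∈ E(G)`, of a gadget `W`. -/
noncomputable def gadgetVerts (k : ℕ) (Vc : Fin k → Finset V)
    (G : SimpleGraph (Fin k)) (W : Fin k → Fin k → Finset V) : Finset V :=
  (Finset.univ.filter fun p : Fin k × Fin k => G.Adj p.1 p.2).biUnion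
    fun p => W p.1 p.2 \ Finset.univ.biUnion Vc

/-- the graph on `[k]` consisting of the paths given by the lists in `L`. -/
def pathsGraph (k : ℕ) (L : List (List (Fin k))) : SimpleGraph (Fin k) :=
  SimpleGraph.fromEdgeSet {e | ∃ l ∈ L, ∃ p ∈ l.zip l.tail, e = s(p.1, p.2)}

/-- `G` is a vertex-disjoint union of paths. -/
def IsUnionOfPaths (k : ℕ) (G : SimpleGraph (Fin k)) : Prop :=
  ∃ L : List (List (Fin k)), (∀ l ∈ L, l.Nodup) ∧
    L.Pairwise (fun l₁ l₂ => ∀ a ∈ l₁, ∀ b ∈ l₂, a ≠ b) ∧ G = pathsGraph k L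

/-- `m(σ)` (1-indexed), read off from the normalized cycle decomposition `L` of `σ`:
the last element of the last cycle, or `1` if `L` is empty. -/
def mOf (k : ℕ) (L : List (List (Fin k))) : ℕ :=
  ((L.getLast?.bind List.getLast?).map (fun x => (x : ℕ) + 1)).getD 1

/-- `L` is the normalized cycle decomposition of `σ`: disjoint cycles of length ≥ 2,
each cycle listed ending with its minimal element, the cycles ordered by increasing
last elements. -/
def IsNormCycleDecomp (k : ℕ) (σ : Equiv.Perm (Fin k)) (L : List (List (Fin k))) : Prop :=
  (∀ l ∈ L, 2 ≤ l.length ∧ l.Nodup) ∧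
  L.Pairwise (fun l₁ l₂ => ∀ a ∈ l₁, ∀ b ∈ l₂, a ≠ b) ∧
  σ = (L.map List.formPerm).prod ∧
  (∀ l ∈ L, ∀ a ∈ l.getLast?, ∀ b ∈ l, a ≤ b) ∧
  L.Pairwise (fun l₁ l₂ => ∀ a ∈ l₁.getLast?, ∀ b ∈ l₂.getLast?, a < b)

/-- `H` is `(μ, θ)`-dense. -/
def IsDense (k : ℕ) (μ θ : ℝ) (E : Finset (Finset V)) : Prop :=
  ∃ 𝒮 : Finset (Finset V), (∀ S ∈ 𝒮, S.card = k - 1) ∧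
    (𝒮.card : ℝ) ≤ θ * ((Fintype.card V).choose (k - 1)) ∧
    ∀ S : Finset V, S.card = k - 1 → S ∉ 𝒮 →
      μ * ((Fintype.card V : ℝ) - k + 1) ≤ (degS E S : ℝ)

/-- `H` is strongly `(μ, θ)`-dense. -/
def IsStronglyDense (k : ℕ) (μ θ : ℝ) (E : Finset (Finset V)) : Prop :=
  IsDense k μ θ E ∧ ∀ e ∈ E, ∀ X ⊆ e, X.card = k - 1 →
    μ * ((Fintype.card V : ℝ) - k + 1) ≤ (degS E X : ℝ)

/-- the vertex set of `F(K,G)` inside the ambient type: all core vertices, plus one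
pendant vertex for each edge of `G`. -/
def FsVertexSet (k : ℕ) (a : Fin k → ℕ) (G : SimpleGraph (Fin k)) :
    Set ((Σ i : Fin k, Fin (a i)) ⊕ Sym2 (Fin k)) :=
  Set.range Sum.inl ∪ Sum.inr '' G.edgeSet

/-- the edges of `F(K,G)`, where `K = K^k(a)`: all transversals of the classes, plus,
for each edge `ij` of `G`, all `k`-sets consisting of the pendant vertex `w_{ij}` and one
vertex from each class other than `i` (resp. other than `j`). -/
def FKGedges (k : ℕ) (a : Fin k → ℕ) (G : SimpleGraph (Fin k)) :
    Set (Finset ((Σ i : Fin k, Fin (a i)) ⊕ Sym2 (Fin k))) :=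
  {e | (∃ g : ∀ i, Fin (a i), e = Finset.univ.image fun i => Sum.inl ⟨i, g i⟩) ∨
    (∃ i j, G.Adj i j ∧ ∃ g : ∀ i', Fin (a i'),
      e = insert (Sum.inr s(i, j)) ((Finset.univ.erase i).image fun i' => Sum.inl ⟨i', g i'⟩))}

/-- `F(K^k(a), G)` contains a spanning copy of the tight cycle `C_s^k`. -/
def FsHasSpanningCs (k s : ℕ) (a : Fin k → ℕ) (G : SimpleGraph (Fin k)) : Prop :=
  ∃ C : List ((Σ i : Fin k, Fin (a i)) ⊕ Sym2 (Fin k)),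
    C.Nodup ∧ C.length = s ∧ (↑C.toFinset : Set _) = FsVertexSet k a G ∧
    ∀ i < C.length, (((C ++ C).drop i).take k).toFinset ∈ FKGedges k a G

/-- `A` is the vertex set of a copy of `K^k(t)` in `H`. -/
def SpansEsCopy (k t : ℕ) (E : Finset (Finset V)) (A : Finset V) : Prop :=
  ∃ f : Fin k × Fin t → V, Function.Injective f ∧ Finset.univ.image f = A ∧
    ∀ g : Fin k → Fin t, (Finset.univ.image fun i => f (i, g i)) ∈ E

/-- `A` is the vertex set of a copy of `F_s = F(K^k(a), G)` in `H`. -/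
def SpansFsCopy (k : ℕ) (a : Fin k → ℕ) (G : SimpleGraph (Fin k))
    (E : Finset (Finset V)) (A : Finset V) : Prop :=
  ∃ f : ((Σ i : Fin k, Fin (a i)) ⊕ Sym2 (Fin k)) → V,
    Set.InjOn f (FsVertexSet k a G) ∧ f '' FsVertexSet k a G = ↑A ∧
    ∀ e ∈ FKGedges k a G, e.image f ∈ E

/-- `(TF, TE)` is an `{F_s, E_s}`-tiling of `H`, given as the families of vertex sets of
the copies of `F_s` and of `E_s = K^k(max_i a_i)`. -/
def IsFETiling (k : ℕ) (a : Fin k → ℕ) (G : SimpleGraph (Fin k))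
    (E : Finset (Finset V)) (TF TE : Finset (Finset V)) : Prop :=
  ((↑(TF ∪ TE) : Set (Finset V)).PairwiseDisjoint id) ∧
  (∀ A ∈ TF, SpansFsCopy k a G E A) ∧
  (∀ A ∈ TE, SpansEsCopy k (Finset.univ.sup a) E A)

/-- `φ(𝒯) = (n - s(|ℱ_𝒯| + (3/5)|ℰ_𝒯|))/n`. -/
noncomputable def phiTiling (s : ℕ) (TF TE : Finset (Finset V)) : ℝ :=
  ((Fintype.card V : ℝ) - s * ((TF.card : ℝ) + (3 / 5) * (TE.card : ℝ))) / (Fintype.card V : ℝ)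

/-- `φ(H)`: the minimum of `φ(𝒯)` over all `{F_s, E_s}`-tilings of `H`. -/
noncomputable def phiMin (k s : ℕ) (a : Fin k → ℕ) (G : SimpleGraph (Fin k))
    (E : Finset (Finset V)) : ℝ :=
  sInf {x | ∃ TF TE : Finset (Finset V), IsFETiling k a G E TF TE ∧ x = phiTiling s TF TE}

/-- `Φ(n, μ, θ)`: the maximum of `φ(H)` over all `(μ,θ)`-dense `k`-graphs `H` on `n` vertices. -/
noncomputable def PhiMax (k s : ℕ) (a : Fin k → ℕ) (G : SimpleGraph (Fin k))
    (n : ℕ) (μ θ : ℝ) : ℝ :=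
  sSup {x | ∃ E : Finset (Finset (Fin n)), IsKGraph k E ∧ IsDense k μ θ E ∧
    x = phiMin k s a G E}

end Defs

theorem card_image_range_inter {V : Type} [DecidableEq V] (g : ℕ → V) (k : ℕ) (A : Finset V)
    (h : ((range k).image g).card = k) :
    ((range k).image g ∩ A).card = ∑ j ∈ range k, if g j ∈ A then 1 else 0 := by
  have hinj : Set.InjOn g (range k) := by
    rw [← Finset.card_image_iff, h, card_range]
  rw [← Finset.filter_mem_eq_inter, Finset.card_filter, Finset.sum_image hinj]

theorem toFinset_window_eq_image {V : Type} [DecidableEq V] (C : List V) (g : ℕ → V)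
    (hg : ∀ n, C[n % C.length]? = some (g n)) {i k : ℕ} (hi : i < C.length)
    (hk : k ≤ C.length) :
    (((C ++ C).drop i).take k).toFinset = (range k).image fun j => g (i + j) := by
  have hw : ((C ++ C).drop i).take k = (List.range k).map fun j => g (i + j) := by
    apply List.ext_getElem?
    intro j
    rw [List.getElem?_take, List.getElem?_map]
    split_ifs with hj
    · rw [List.getElem?_range hj, Option.map_some, ← hg, List.getElem?_drop]
      rcases lt_or_ge (i + j) C.length with h | h
      · rw [List.getElem?_append_left h, Nat.mod_eq_of_lt h]
      · rw [List.getElem?_append_right h, Nat.mod_eq_sub_mod h, Nat.mod_eq_of_lt (by omega)]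
    · rw [List.getElem?_eq_none (by simpa using hj), Option.map_none]
  ext v
  simp [hw]

theorem periodic_of_window_sum_parity {f : ℕ → ℕ} {k : ℕ} (hf : ∀ n, f n ≤ 1)
    (hw : ∀ i, ¬ (∑ j ∈ range k, f (i + j)) % 2 = k % 2) : Function.Periodic f k := by
  intro n
  have hshift : f n + ∑ j ∈ range k, f (n + 1 + j) = ∑ j ∈ range k, f (n + j) + f (n + k) := by
    rw [← Finset.sum_range_succ (fun j => f (n + j)), Finset.sum_range_succ', add_comm]
    simp only [add_zero, add_assoc, add_comm 1]
  have := hw n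
  have := hw (n + 1)
  have := hf n
  have := hf (n + k)
  omega

theorem Function.Periodic.nat_gcd {α : Type*} {f : ℕ → α} {k s : ℕ} (hk : Function.Periodic f k)
    (hs : Function.Periodic f s) : Function.Periodic f (Nat.gcd k s) := by
  intro n
  rcases Nat.eq_zero_or_pos s with rfl | hpos
  · rw [Nat.gcd_zero_right]
    exact hk n
  rcases (Nat.gcd_le_right k hpos).eq_or_lt with h | h
  · rw [h]
    exact hs n
  obtain ⟨m, -, hm⟩ := Nat.exists_mul_mod_eq_gcd h
  calc f (n + Nat.gcd k s) = f (n + Nat.gcd k s + (k * m / s) * s) := (hs.nat_mul _ _).symm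
    _ = f (n + m * k) := by
      rw [add_assoc, ← hm, Nat.mod_add_div', mul_comm k m]
    _ = f n := hk.nat_mul m n

theorem Function.Periodic.sum_range_mul {f : ℕ → ℕ} {d : ℕ} (hf : Function.Periodic f d) (m : ℕ) :
    ∑ j ∈ range (m * d), f j = m * ∑ j ∈ range d, f j := by
  induction m with
  | zero => simp
  | succ m ih =>
    rw [Nat.succ_mul, Finset.sum_range_add, ih, Nat.succ_mul]
    congr 1
    refine Finset.sum_congr rfl fun j _ => ?_
    rw [add_comm]
    exact hf.nat_mul m j

/-- A `0`-`1` sequence with period `s` all of whose windows of length `k` have sum of parity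
different from `k`, and which is not identically zero, forces `k / gcd k s` to be odd and
`gcd k s ≥ 2`. -/
theorem gcd_of_window_sum_parity {f : ℕ → ℕ} {k s : ℕ} (hk : 0 < k) (hf : ∀ n, f n ≤ 1)
    (hs : Function.Periodic f s) (hw : ∀ i, ¬ (∑ j ∈ range k, f (i + j)) % 2 = k % 2)
    (hne : ∑ j ∈ range s, f j ≠ 0) :
    (s / Nat.gcd k s) ∣ ∑ j ∈ range s, f j ∧ 2 ≤ Nat.gcd k s ∧ Odd (k / Nat.gcd k s) := by
  have hd := (periodic_of_window_sum_parity hf hw).nat_gcd hs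
  have hdpos : 0 < Nat.gcd k s := Nat.gcd_pos_of_pos_left s hk
  have hdk : k / Nat.gcd k s * Nat.gcd k s = k := Nat.div_mul_cancel (Nat.gcd_dvd_left k s)
  have hds : s / Nat.gcd k s * Nat.gcd k s = s := Nat.div_mul_cancel (Nat.gcd_dvd_right k s)
  have hsum_s := hd.sum_range_mul (s / Nat.gcd k s)
  have hsum_k := hd.sum_range_mul (k / Nat.gcd k s)
  rw [hds] at hsum_s
  rw [hdk] at hsum_k
  have hw0 := hw 0
  simp only [zero_add] at hw0
  have hodd : Odd (k / Nat.gcd k s) := by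
    by_contra he
    rw [Nat.not_odd_iff_even] at he
    have hk2 : Even k := hdk ▸ he.mul_right (Nat.gcd k s)
    have hsum2 : Even (∑ j ∈ range k, f j) := hsum_k ▸ he.mul_right _
    rw [Nat.even_iff] at hk2 hsum2
    omega
  refine ⟨⟨_, hsum_s⟩, ?_, hodd⟩
  by_contra hlt
  have hd1 : Nat.gcd k s = 1 := by omega
  rw [hd1, Nat.div_one, Finset.sum_range_one] at hsum_k hsum_s
  rw [hd1, Nat.div_one, Nat.odd_iff] at hodd
  have hf0 : f 0 = 1 := by
    have := hf 0
    have : f 0 ≠ 0 := fun h => hne (by rw [hsum_s, h, mul_zero])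
    omega
  rw [hf0, mul_one] at hsum_k
  exact hw0 (by rw [hsum_k])

/-- if `H₀^k(A,B)` contains a copy `C` of `C_s^k` meeting `A`, then
`|V(C) ∩ A| ≡ 0 (mod s/d)` where `d = gcd(k,s)`, and `(k,s)` is not admissible. -/
theorem cyclic_gcd {V : Type} [Fintype V] [DecidableEq V] (k s : ℕ) (hk : 3 ≤ k) (hks : k ≤ s)
    (A B : Finset V) (hAB : Disjoint A B)
    (C : List V) (hC : IsTightCycleList k (H0edges k A B) C) (hlen : C.length = s)
    (hCA : (C.toFinset ∩ A).Nonempty) :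
    (s / Nat.gcd k s) ∣ (C.toFinset ∩ A).card ∧
      2 ≤ Nat.gcd k s ∧ Odd (k / Nat.gcd k s) := by
  subst hlen
  obtain ⟨hnodup, hedge⟩ := hC
  have hpos : 0 < C.length := by omega
  let g : ℕ → V := fun n => C[n % C.length]'(Nat.mod_lt n hpos)
  have hg : ∀ n, C[n % C.length]? = some (g n) := fun n => List.getElem?_eq_getElem _
  have hper : Function.Periodic g C.length := fun n => by simp only [g, Nat.add_mod_right]
  let f : ℕ → ℕ := fun n => if g n ∈ A then 1 else 0
  have hfper : Function.Periodic f C.length := fun n => by simp only [f, hper n]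
  have hC' : C.toFinset = (range C.length).image g := by
    simpa using toFinset_window_eq_image C g hg hpos le_rfl
  have hcard : (C.toFinset ∩ A).card = ∑ j ∈ range C.length, f j := by
    rw [hC']
    exact card_image_range_inter g C.length A (by rw [← hC', List.toFinset_card_of_nodup hnodup])
  have hw : ∀ i, ¬ (∑ j ∈ range k, f (i + j)) % 2 = k % 2 := by
    intro i
    have hi := Nat.mod_lt i hpos
    have he := hedge _ hi
    rw [toFinset_window_eq_image C g hg hi hks, H0edges, Finset.mem_filter,
      Finset.mem_powersetCard] at he
    obtain ⟨⟨-, hk'⟩, hpar⟩ := he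
    rw [card_image_range_inter _ k A hk'] at hpar
    have hmod : ∀ j, f (i + j) = f (i % C.length + j) := fun j => by
      simp only [f, g, Nat.mod_add_mod]
    simpa only [hmod] using hpar
  rw [hcard]
  refine gcd_of_window_sum_parity (by omega) (fun n => ?_) hfper hw ?_
  · simp only [f]
    split_ifs <;> simp
  · rw [← hcard]
    exact hCA.card_pos.ne'
end

section
/- Let k ≥ 3 and r ≥ 2 be integers, let σ = (i₁ i₂ ⋯ i_r) be a cyclic permutation of [k] of length r, and let G be a graph on [k] containing the path Q = i₁ i₂ ⋯ i_r. Let H be a k-graph containing a complete (k,k)-graph K with vertex classes V₁,…,V_k, and let P be a tight path in H with end of type π for some permutation π of [k] with π(1) = i_r. Suppose K has a G-gadget W_G avoiding V(P), and |V_{i_j} ∖ V(P)| ≥ 2|E(G)| for all 1 ≤ j ≤ r. Then there exists a tight path P' extending P with end of type σπ such that: (i) |V(P')| = |V(P)| + 2k(r−1); (ii) for all 1 ≤ i ≤ k, |V_i ∩ (V(P') ∖ V(P))| = 2(r−1) − 1 if i ∈ {i₁,…,i_{r−1}} and = 2(r−1) otherwise; (iii) K has a (G − Q)-gadget avoiding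 V(P'), where G − Q is G with the edges of Q removed; (iv) V(P') ∖ (V(P) ∪ V(K)) = { w_{i_j i_{j+1}} : 1 ≤ j < r }. -/
set_option autoImplicit false

open Finset

/-- A two-element infix of `a :: b :: m` is either the initial pair or an infix of `b :: m`. -/
theorem pair_infix_cons_cons {α : Type*} {x y a b : α} {m : List α} :
    [x, y] <:+: a :: b :: m ↔ (x = a ∧ y = b) ∨ [x, y] <:+: b :: m := by
  rw [List.infix_cons_iff]
  simp [List.cons_prefix_cons]

theorem not_pair_infix_singleton {α : Type*} {x y a : α} : ¬ [x, y] <:+: [a] := by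
  intro h
  simpa using h.length_le

theorem pair_infix_iff_mem_zip_tail {α : Type*} {x y : α} (l : List α) :
    [x, y] <:+: l ↔ (x, y) ∈ l.zip l.tail := by
  induction l with
  | nil => simp
  | cons a m ih =>
    cases m with
    | nil => simp [not_pair_infix_singleton]
    | cons b m =>
      rw [pair_infix_cons_cons, ih]
      simp

theorem pathsGraph_adj_iff {k : ℕ} {l : List (Fin k)} (hl : l.Nodup) {a b : Fin k} :
    (pathsGraph k [l]).Adj a b ↔ [a, b] <:+: l ∨ [b, a] <:+: l := by
  have hne : ∀ {x y : Fin k}, [x, y] <:+: l → x ≠ y := fun h => by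
    simpa using hl.sublist h.sublist
  simp only [pathsGraph, SimpleGraph.fromEdgeSet_adj, Set.mem_ofPred_eq, List.mem_singleton,
    exists_eq_left, Prod.exists, ← pair_infix_iff_mem_zip_tail, Sym2.eq_iff]
  constructor
  · rintro ⟨⟨x, y, h, ⟨rfl, rfl⟩ | ⟨rfl, rfl⟩⟩, -⟩
    · exact Or.inl h
    · exact Or.inr h
  · rintro (h | h)
    · exact ⟨⟨a, b, h, Or.inl ⟨rfl, rfl⟩⟩, hne h⟩
    · exact ⟨⟨b, a, h, Or.inr ⟨rfl, rfl⟩⟩, (hne h).symm⟩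

theorem hasEndType.append {V : Type} {k : ℕ} {Vc : Fin k → Finset V} {P Q : List V}
    {π : Equiv.Perm (Fin k)} (h : hasEndType k Vc Q π) :
    hasEndType k Vc (P ++ Q) π := by
  obtain ⟨h1, h2⟩ := h
  refine ⟨by simp; omega, fun j hj v hv => h2 j hj v ?_⟩
  have hj' : 0 < (j : ℕ) := Nat.pos_of_ne_zero hj
  rwa [List.length_append, List.getElem?_append_right (by omega),
    show P.length + Q.length + (j : ℕ) - k - P.length = Q.length + j - k by omega] at hv

section Gadget

variable {V : Type} [DecidableEq V] {k : ℕ} {E : Finset (Finset V)}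
  {Vc : Fin k → Finset V}

/-- A list whose entries lie in the classes in some order without repetition is an edge. -/
theorem IsCompletePartite.toFinset_mem (hK : IsCompletePartite k E Vc) {L : List V}
    (hL : L.length = k) {ρ : Fin k → Fin k} (hρ : Function.Injective ρ)
    (h : ∀ t : Fin k, L[(t : ℕ)]'(by omega) ∈ Vc (ρ t)) : L.toFinset ∈ E := by
  let e := Equiv.ofBijective ρ (Finite.injective_iff_bijective.1 hρ)
  have key := hK.2.2 (fun c => L[(e.symm c : ℕ)]'(by omega)) fun c => by
    have := h (e.symm c)
    rwa [show ρ (e.symm c) = c from e.apply_symm_apply c] at this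
  convert key using 1
  ext v
  simp only [List.mem_toFinset, Finset.mem_image, Finset.mem_univ, true_and, List.mem_iff_getElem]
  constructor
  · rintro ⟨t, ht, rfl⟩
    exact ⟨e ⟨t, by omega⟩, by simp⟩
  · rintro ⟨c, rfl⟩
    exact ⟨_, _, rfl⟩

theorem IsTightPath.append_cons (hk : 0 < k) (hK : IsCompletePartite k E Vc) {P Q : List V} {x : V}
    {π : Equiv.Perm (Fin k)} (hP : IsTightPath k E P) (hPend : hasEndType k Vc P π)
    (hQ : IsTightPath k E Q) (hQstart : hasStartType k Vc Q (π * cyc k))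
    (hx : x ∈ Vc (π ⟨0, hk⟩)) (hnd : (P ++ x :: Q).Nodup) : IsTightPath k E (P ++ x :: Q) := by
  refine ⟨hnd, fun i hi => ?_⟩
  simp only [List.length_append, List.length_cons] at hi
  rcases le_or_gt (i + k) P.length with h1 | h1
  · rw [List.drop_append_of_le_length (by omega), List.take_append_of_le_length (by simp; omega)]
    exact hP.2 i h1
  rcases le_or_gt (P.length + 1) i with h2 | h2
  · obtain ⟨u, rfl⟩ := Nat.exists_eq_add_of_le h2
    have : (P ++ x :: Q).drop (P.length + 1 + u) = Q.drop u := by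
      rw [add_assoc, List.drop_append]
      simp [add_comm 1 u]
    rw [this]
    exact hQ.2 u (by omega)
  · have hP1 := hPend.1
    have hQ1 := hQstart.1
    refine hK.toFinset_mem (ρ := fun t => π ⟨(i + t + k - P.length) % k, Nat.mod_lt _ hk⟩)
      (by simp; omega) ?_ ?_
    · intro s t hst
      have h3 := congrArg Fin.val (π.injective hst)
      simp only at h3
      have h4 : (i + k - P.length) + s.1 ≡ (i + k - P.length) + t.1 [MOD k] := by
        unfold Nat.ModEq
        convert h3 using 2 <;> omega
      have h5 := Nat.ModEq.add_left_cancel' _ h4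
      exact Fin.ext (Nat.ModEq.eq_of_lt_of_lt h5 s.2 t.2)
    · intro t
      have ht := t.2
      rw [List.getElem_take, List.getElem_drop]
      rcases lt_trichotomy (i + t.1) P.length with h3 | h3 | h3
      · rw [List.getElem_append_left h3]
        have := hPend.2 ⟨i + t + k - P.length, by omega⟩ (by simp; omega) P[i + t.1] (by
          rw [Option.mem_def, List.getElem?_eq_some_iff]
          refine ⟨by simp; omega, ?_⟩
          congr 1
          simp; omega)
        convert this using 4
        exact Nat.mod_eq_of_lt (by omega)
      · rw [List.getElem_append_right (by omega)]
        simp only [h3, Nat.sub_self, List.getElem_cons_zero]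
        simpa using hx
      · obtain ⟨u, hu⟩ := Nat.exists_eq_add_of_lt h3
        rw [List.getElem_append_right (by omega)]
        simp only [show i + t.1 - P.length = u + 1 by omega, List.getElem_cons_succ]
        have := hQstart.2 ⟨u, by omega⟩ (by simp; omega) (Q[u]'(by omega)) (by simp)
        convert this using 2
        rw [Equiv.Perm.mul_apply]
        congr 1
        obtain ⟨n, rfl⟩ := Nat.exists_eq_succ_of_ne_zero hk.ne'
        rw [cyc, finRotate_of_lt (by omega)]
        ext
        simp only
        rw [show i + t.1 + n.succ - P.length = (u + 1) + n.succ by omega, Nat.add_mod_right]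
        exact Nat.mod_eq_of_lt (by omega)

/-- A vertex class incident to an edge of `G` and with at least `2 e(G)` vertices outside `S`
has a vertex outside `S` and outside the gadget. -/
theorem IsGadget.exists_mem_notMem {G : SimpleGraph (Fin k)} {S T : Finset V}
    {W : Fin k → Fin k → Finset V} (hW : IsGadget k E Vc G T W) {j b : Fin k} (hjb : G.Adj j b)
    (hS : 2 * G.edgeSet.ncard ≤ (Vc j \ S).card) :
    ∃ x ∈ Vc j, x ∉ S ∧ ∀ a c, G.Adj a c → x ∉ W a c := by
  classical
  let F : Sym2 (Fin k) → Finset V := fun e => W e.out.1 e.out.2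
  have hF : ∀ a c, G.Adj a c → F s(a, c) = W a c := fun a c hac => by
    have h : s((s(a, c) : Sym2 (Fin k)).out.1, (s(a, c) : Sym2 (Fin k)).out.2) = s(a, c) :=
      Quot.out_eq _
    rcases Sym2.eq_iff.1 h with ⟨h1, h2⟩ | ⟨h1, h2⟩
    · simp only [F, h1, h2]
    · simp only [F, h1, h2, hW.1 a c hac]
  have hcard : ∀ a c, G.Adj a c → (F s(a, c) ∩ Vc j).card = if j = a ∨ j = c then 1 else 2 :=
    fun a c hac => by rw [hF a c hac, (hW.2.1 a c hac).2.2.2.1 j]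
  have hlt : (G.edgeFinset.biUnion fun e => F e ∩ Vc j).card < (Vc j \ S).card := by
    refine lt_of_lt_of_le ?_ hS
    calc _ ≤ ∑ e ∈ G.edgeFinset, (F e ∩ Vc j).card := Finset.card_biUnion_le
      _ < ∑ e ∈ G.edgeFinset, 2 := by
        refine Finset.sum_lt_sum ?_ ⟨s(j, b), by simpa using hjb, by simp [hcard j b hjb]⟩
        intro e he
        induction e with
        | _ a c =>
          rw [hcard a c (by simpa using he)]
          split_ifs <;> simp
      _ = 2 * G.edgeSet.ncard := by
        rw [Finset.sum_const, smul_eq_mul, mul_comm, ← SimpleGraph.coe_edgeFinset,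
          Set.ncard_coe_finset]
  obtain ⟨x, hx, hx'⟩ := Finset.exists_mem_notMem_of_card_lt_card hlt
  rw [Finset.mem_sdiff] at hx
  refine ⟨x, hx.1, hx.2, fun a c hac hxW => hx' ?_⟩
  exact Finset.mem_biUnion.2 ⟨s(a, c), by simpa using hac,
    Finset.mem_inter.2 ⟨by rwa [hF a c hac], hx.1⟩⟩

/-- Extending a tight path through the gadget edges along `m`, a path of `G` traversed from the
class at which the tight path ends. -/
theorem IsGadget.exists_append {G : SimpleGraph (Fin k)} {W : Fin k → Fin k → Finset V}
    {S : Finset V} (hk : 0 < k) (hK : IsCompletePartite k E Vc) (hW : IsGadget k E Vc G S W)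
    (j : Fin k) (m : List (Fin k)) (hnd : (j :: m).Nodup) (hG : (j :: m).IsChain G.Adj)
    (P : List V) (hP : IsTightPath k E P) (π : Equiv.Perm (Fin k)) (hPend : hasEndType k Vc P π)
    (hπ : π ⟨0, hk⟩ = j)
    (hPW : ∀ a b, [a, b] <:+: j :: m → Disjoint (W a b) P.toFinset)
    (hfree : ∀ i ∈ (j :: m).dropLast, ∃ x ∈ Vc i, x ∉ P ∧ ∀ a b, G.Adj a b → x ∉ W a b) :
    ∃ Q : List V, IsTightPath k E (P ++ Q) ∧
      hasEndType k Vc (P ++ Q) ((j :: m).formPerm⁻¹ * π) ∧ Q.length = 2 * k * m.length ∧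
      (∀ i, (Vc i ∩ Q.toFinset).card + (if i ∈ m then 1 else 0) = 2 * m.length) ∧
      (∀ v ∈ Q, (∃ a b, [a, b] <:+: j :: m ∧ v ∈ W a b) ∨
        ((∃ i, v ∈ Vc i) ∧ ∀ a b, G.Adj a b → v ∉ W a b)) ∧
      (∀ a b, [a, b] <:+: j :: m → ∀ v ∈ W a b, v ∈ Q) := by
  induction m generalizing j P π with
  | nil =>
    refine ⟨[], by simpa using hP, by simpa using hPend, by simp, by simp, by simp, ?_⟩
    intro a b h
    exact (not_pair_infix_singleton h).elim
  | cons i m ih =>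
    obtain ⟨hji, hGm⟩ := List.isChain_cons_cons.1 hG
    obtain ⟨hjm, hndm⟩ := List.nodup_cons.1 hnd
    have hij : j ≠ i := fun h => hjm (by simp [h])
    obtain ⟨hWcard, -, -, hWV, hWpath⟩ := hW.2.1 j i hji
    obtain ⟨R, hR, hRW, hRstart, hRend⟩ := hWpath π ⟨⟨0, hk⟩, rfl, Or.inl hπ⟩
    have hRmem : ∀ v, v ∈ R ↔ v ∈ W j i := fun v => by rw [← hRW, List.mem_toFinset]
    obtain ⟨x, hxV, hxP, hxW⟩ := hfree j (by simp)
    have hxR : x ∉ R := by rw [hRmem]; exact hxW j i hji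
    have hdisj : ∀ v ∈ P, v ∉ R := fun v hv hvR =>
      Finset.disjoint_left.1 (hPW j i (pair_infix_cons_cons.2 (Or.inl ⟨rfl, rfl⟩)))
        ((hRmem v).1 hvR) (List.mem_toFinset.2 hv)
    have hnodup : (P ++ x :: R).Nodup := by
      refine List.Nodup.append hP.1 (List.nodup_cons.2 ⟨hxR, hR.1⟩) ?_
      intro v hv hv'
      rcases List.mem_cons.1 hv' with rfl | h
      · exact hxP hv
      · exact hdisj v hv h
    have hadj : ∀ a b, [a, b] <:+: i :: m → G.Adj a b := fun a b h => by
      simpa using hGm.infix h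
    have hWW : ∀ a b, [a, b] <:+: i :: m → Disjoint (W a b) (W j i) := fun a b h => by
      refine hW.2.2 a b j i (hadj a b h) hji fun heq => hjm ?_
      have hj : j ∈ ({a, b} : Finset (Fin k)) := by simp [heq]
      exact h.subset (by simpa using hj)
    obtain ⟨Q, hQ1, hQ2, hQ3, hQ4, hQ5, hQ6⟩ := ih i hndm hGm (P ++ x :: R)
      (hP.append_cons hk hK hPend hR hRstart (by rwa [hπ]) hnodup) (Equiv.swap j i * π)
      (by rw [List.append_cons]; exact hRend.append) (by simp [hπ])
      (fun a b h => by
        rw [Finset.disjoint_left]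
        intro v hv hv'
        simp only [List.mem_toFinset, List.mem_append, List.mem_cons] at hv'
        rcases hv' with h' | rfl | h'
        · exact Finset.disjoint_left.1 (hPW a b (pair_infix_cons_cons.2 (Or.inr h))) hv
            (List.mem_toFinset.2 h')
        · exact hxW a b (hadj a b h) hv
        · exact Finset.disjoint_left.1 (hWW a b h) hv ((hRmem v).1 h'))
      (fun c hc => by
        obtain ⟨y, hyV, hyP, hyW⟩ := hfree c (by
          rw [List.dropLast_cons_of_ne_nil (by simp)]; exact List.mem_cons_of_mem _ hc)
        refine ⟨y, hyV, ?_, hyW⟩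
        simp only [List.mem_append, List.mem_cons, not_or]
        refine ⟨hyP, ?_, fun h => hyW j i hji ((hRmem y).1 h)⟩
        rintro rfl
        refine Finset.disjoint_left.1 (hK.2.1 c j ?_) hyV hxV
        rintro rfl
        exact hjm (List.mem_of_mem_dropLast hc))
    refine ⟨x :: R ++ Q, by simpa using hQ1, ?_, ?_, ?_, ?_, ?_⟩
    · have : (j :: i :: m).formPerm⁻¹ * π = (i :: m).formPerm⁻¹ * (Equiv.swap j i * π) := by
        rw [List.formPerm_cons_cons, mul_inv_rev, Equiv.swap_inv, mul_assoc]
      rw [this]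
      simpa using hQ2
    · have : R.length = 2 * k - 1 := by
        rw [← List.toFinset_card_of_nodup hR.1, hRW, hWcard]
      simp only [List.length_append, List.length_cons, hQ3, this, mul_add]
      omega
    · intro c
      have hdis : Disjoint (Vc c ∩ (x :: R).toFinset) (Vc c ∩ Q.toFinset) := by
        rw [Finset.disjoint_left]
        intro v hv hv'
        simp only [Finset.mem_inter, List.mem_toFinset] at hv hv'
        exact List.disjoint_of_nodup_append hQ1.1 (List.mem_append_right P hv.2) hv'.2
      have h1 : (Vc c ∩ (x :: R).toFinset).card = (Vc c ∩ W j i).card + if c = j then 1 else 0 := by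
        rw [List.toFinset_cons, hRW]
        split_ifs with h
        · subst h
          rw [Finset.inter_insert_of_mem hxV, Finset.card_insert_of_notMem]
          simp [hxW c i hji]
        · rw [Finset.inter_insert_of_notMem, add_zero]
          exact fun hx => Finset.disjoint_left.1 (hK.2.1 c j h) hx hxV
      rw [List.toFinset_append, Finset.inter_union_distrib_left, Finset.card_union_of_disjoint hdis,
        h1, Finset.inter_comm, hWV c]
      have h2 := hQ4 c
      simp only [List.length_cons, List.mem_cons]
      have hjm' : j ∉ m := fun h => hjm (List.mem_cons_of_mem _ h)
      have him := (List.nodup_cons.1 hndm).1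
      by_cases hcj : c = j
      · subst hcj
        simp [hij, hjm'] at h2 ⊢
        omega
      · by_cases hci : c = i
        · subst hci
          simp [hcj, him] at h2 ⊢
          omega
        · simp only [hcj, hci, false_or, if_false] at h2 ⊢
          omega
    · intro v hv
      simp only [List.mem_append, List.mem_cons] at hv
      rcases hv with (rfl | hv) | hv
      · exact Or.inr ⟨⟨j, hxV⟩, hxW⟩
      · exact Or.inl ⟨j, i, pair_infix_cons_cons.2 (Or.inl ⟨rfl, rfl⟩), (hRmem v).1 hv⟩
      · refine (hQ5 v hv).imp_left ?_
        rintro ⟨a, b, h, hv⟩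
        exact ⟨a, b, pair_infix_cons_cons.2 (Or.inr h), hv⟩
    · intro a b h v hv
      rcases pair_infix_cons_cons.1 h with ⟨rfl, rfl⟩ | h
      · exact List.mem_append_left _ (List.mem_cons_of_mem _ ((hRmem v).2 hv))
      · exact List.mem_append_right _ (hQ6 a b h v hv)

end Gadget

/-- extending a tight path through a gadget along a cyclic permutation
`σ = (i₁ i₂ ⋯ i_r)`, given (as the list `l = [i₁, …, i_r]`) together with its path
`Q = i₁ i₂ ⋯ i_r` inside `G`. -/
theorem gadget_cycle {V : Type} [Fintype V] [DecidableEq V] (k r : ℕ) (hk : 3 ≤ k) (hr : 2 ≤ r)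
    (l : List (Fin k)) (hlnd : l.Nodup) (hlen : l.length = r)
    (σ : Equiv.Perm (Fin k)) (hσ : σ = l.formPerm)
    (G : SimpleGraph (Fin k)) (hQG : l.Chain' G.Adj)
    (E : Finset (Finset V)) (hE : IsKGraph k E)
    (Vc : Fin k → Finset V) (hK : IsCompletePartite k E Vc)
    (P : List V) (hP : IsTightPath k E P)
    (π : Equiv.Perm (Fin k)) (hPend : hasEndType k Vc P π)
    (hπ : ∀ z : Fin k, (z : ℕ) = 0 → l.getLast? = some (π z))
    (W : Fin k → Fin k → Finset V) (hW : IsGadget k E Vc G P.toFinset W)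
    (hspace : ∀ j ∈ l, 2 * G.edgeSet.ncard ≤ ((Vc j) \ P.toFinset).card) :
    ∃ P' Q' : List V, P' = P ++ Q' ∧ IsTightPath k E P' ∧ hasEndType k Vc P' (σ * π) ∧
      P'.length = P.length + 2 * k * (r - 1) ∧
      (∀ i : Fin k, (Vc i ∩ (P'.toFinset \ P.toFinset)).card =
        if i ∈ l.dropLast then 2 * (r - 1) - 1 else 2 * (r - 1)) ∧
      (∃ W' : Fin k → Fin k → Finset V,
        IsGadget k E Vc (G.deleteEdges (pathsGraph k [l]).edgeSet) P'.toFinset W') ∧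
      P'.toFinset \ (P.toFinset ∪ Finset.univ.biUnion Vc) =
        gadgetVerts k Vc (pathsGraph k [l]) W := by
  have hk0 : 0 < k := by omega
  subst hσ hlen
  obtain ⟨j, m, hlr⟩ : ∃ j m, l.reverse = j :: m :=
    List.exists_cons_of_ne_nil (by rintro h; simp_all)
  have hl : l = (j :: m).reverse := by rw [← hlr, List.reverse_reverse]
  have hnd : (j :: m).Nodup := by rw [← hlr]; exact List.nodup_reverse.2 hlnd
  have hchain : (j :: m).IsChain G.Adj := by
    rw [← hlr, List.isChain_reverse]
    exact hQG.imp fun a b h => h.symm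
  have hinfix : ∀ a b, [a, b] <:+: j :: m ↔ [b, a] <:+: l := fun a b => by
    rw [← hlr, ← List.reverse_infix]
    simp
  have hadj : ∀ a b, [a, b] <:+: j :: m → G.Adj a b := fun a b h => by
    simpa using hchain.infix h
  have hpath : ∀ a b, (pathsGraph k [l]).Adj a b ↔ [a, b] <:+: j :: m ∨ [b, a] <:+: j :: m :=
    fun a b => by rw [pathsGraph_adj_iff hlnd, hinfix, hinfix, or_comm]
  have hπj : π ⟨0, hk0⟩ = j := by
    have := hπ ⟨0, hk0⟩ rfl
    rw [hl] at this
    simpa using this.symm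
  have hfree : ∀ i ∈ (j :: m).dropLast, ∃ x ∈ Vc i, x ∉ P ∧ ∀ a b, G.Adj a b → x ∉ W a b := by
    intro i hi
    obtain ⟨b, hb⟩ : ∃ b, G.Adj i b := by
      obtain ⟨n, hn, rfl⟩ := List.mem_iff_getElem.1 hi
      rw [List.length_dropLast] at hn
      refine ⟨(j :: m)[n + 1], ?_⟩
      rw [List.getElem_dropLast]
      exact List.isChain_iff_getElem.1 hchain n (by omega)
    obtain ⟨x, h1, h2, h3⟩ := hW.exists_mem_notMem hb
      (hspace i (by rw [hl, List.mem_reverse]; exact List.mem_of_mem_dropLast hi))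
    exact ⟨x, h1, by simpa using h2, h3⟩
  obtain ⟨Q, hQ1, hQ2, hQ3, hQ4, hQ5, hQ6⟩ := hW.exists_append hk0 hK j m hnd hchain P hP π hPend
    hπj (fun a b h => (hW.2.1 a b (hadj a b h)).2.2.1) hfree
  have hlen : l.length - 1 = m.length := by simp [hl]
  have hsdiff : (P ++ Q).toFinset \ P.toFinset = Q.toFinset := by
    rw [List.toFinset_append, Finset.union_sdiff_left, Finset.sdiff_eq_self_iff_disjoint,
      List.disjoint_toFinset_iff_disjoint]
    exact (List.disjoint_of_nodup_append hQ1.1).symm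
  refine ⟨P ++ Q, Q, rfl, hQ1, ?_, ?_, ?_, ⟨W, ?_⟩, ?_⟩
  · rwa [hl, List.formPerm_reverse]
  · rw [List.length_append, hQ3, hlen]
  · intro i
    have h := hQ4 i
    have hmem : i ∈ l.dropLast ↔ i ∈ m := by simp [hl]
    rw [hsdiff, hlen]
    simp only [hmem]
    split_ifs at h ⊢ <;> omega
  · refine ⟨fun a b h => hW.1 a b h.1, fun a b h => ?_,
      fun a b c d h h' => hW.2.2 a b c d h.1 h'.1⟩
    obtain ⟨h1, h2, h3, h4, h5⟩ := hW.2.1 a b h.1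
    refine ⟨h1, h2, ?_, h4, h5⟩
    rw [List.toFinset_append, Finset.disjoint_union_right]
    refine ⟨h3, Finset.disjoint_left.2 fun v hv hvQ => ?_⟩
    rcases hQ5 v (List.mem_toFinset.1 hvQ) with ⟨c, d, hcd, hv'⟩ | ⟨-, hv'⟩
    · refine Finset.disjoint_left.1 (hW.2.2 a b c d h.1 (hadj c d hcd) fun heq => ?_) hv hv'
      have hs : s(a, b) = s(c, d) :=
        Sym2.ext fun x => by simpa using Finset.ext_iff.1 heq x
      have hnot := (SimpleGraph.deleteEdges_adj.1 h).2
      rw [hs, SimpleGraph.mem_edgeSet, hpath] at hnot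
      exact hnot (Or.inl hcd)
    · exact hv' a b h.1 hv
  · ext v
    rw [← Finset.sup_eq_union, ← sdiff_sdiff_left, hsdiff]
    simp only [gadgetVerts, Finset.mem_sdiff, Finset.mem_biUnion, Finset.mem_filter,
      Finset.mem_univ, true_and, List.mem_toFinset, Prod.exists, hpath]
    constructor
    · rintro ⟨hv, hv'⟩
      rcases hQ5 v hv with ⟨a, b, hab, hvW⟩ | ⟨h, -⟩
      · exact ⟨a, b, Or.inl hab, hvW, hv'⟩
      · exact (hv' h).elim
    · rintro ⟨a, b, hab | hab, hvW, hv'⟩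
      · exact ⟨hQ6 a b hab v hvW, hv'⟩
      · exact ⟨hQ6 b a hab v (by rwa [hW.1 b a (hadj b a hab)]), hv'⟩
end

section
/- Let k ≥ 3 be an integer. Let H be a k-graph containing a complete (k,k)-graph K with vertex classes V₁,…,V_k and a tight path P with end of type id. Let σ be a permutation of [k] and let G be a graph on [k] containing G_σ. Suppose K has a G-gadget W_G avoiding V(P), and |V_i ∖ V(P)| ≥ 2|E(G)| + 2 for all 1 ≤ i ≤ k. Then there exists a tight path P' extending P with end of type στ^{m(σ)−1} such that: (i) |V(P')| = |V(P)| + 2k|E(G_σ)| + m(σ) − 1; (ii) for all 1 ≤ i ≤ k, |V_i ∩ (V(P') ∖ V(P))| = 2|E(G_σ)| − X_{i,σ} + Y_{i,σ}; (iii) K has a (G − G_σ)-gadget avoiding V(P'), where G − G_σ is G with the edges of G_σ removed; (iv) V(P') ∖ (V(P) ∪ V(K)) = { w_{ij} : ij ∈ E(G_σ) }. -/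
set_option autoImplicit false

open Finset

section Extension

variable {V : Type} {k : ℕ} {Vc : Fin k → Finset V}

theorem hasEndType.append_left {Q : List V} {ρ : Equiv.Perm (Fin k)}
    (hQ : hasEndType k Vc Q ρ) (A : List V) : hasEndType k Vc (A ++ Q) ρ := by
  refine ⟨by have := hQ.1; simp; omega, fun j hj v hv => hQ.2 j hj v ?_⟩
  have := hQ.1
  rw [List.getElem?_append_right (by simp; omega)] at hv
  convert hv using 2
  simp; omega

theorem cyc_val_of_lt {j : Fin k} (h : (j : ℕ) + 1 < k) : cyc k j = ⟨j + 1, h⟩ := by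
  obtain ⟨k, rfl⟩ : ∃ n, k = n + 1 := ⟨k - 1, by omega⟩
  exact finRotate_of_lt (by omega)

theorem cyc_of_eq {j : Fin k} (h : (j : ℕ) + 1 = k) : cyc k j = ⟨0, by omega⟩ := by
  obtain ⟨k, rfl⟩ : ∃ n, k = n + 1 := ⟨k - 1, by omega⟩
  obtain rfl : j = Fin.last k := Fin.ext (by simp; omega)
  exact finRotate_last

theorem hasEndType.concat (hk : 0 < k) {A : List V} {ρ : Equiv.Perm (Fin k)} {v : V}
    (hA : hasEndType k Vc A ρ) (hv : v ∈ Vc (ρ ⟨0, hk⟩)) :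
    hasEndType k Vc (A ++ [v]) (ρ * cyc k) := by
  have hlen := hA.1
  refine ⟨by simp; omega, fun j hj u hu => ?_⟩
  rw [Equiv.Perm.mul_apply]
  by_cases h : (j : ℕ) + 1 < k
  · rw [cyc_val_of_lt h]
    refine hA.2 _ (by simp) u ?_
    rw [List.getElem?_append_left (by simp; omega)] at hu
    convert hu using 2
    simp; omega
  · have h : (j : ℕ) + 1 = k := by omega
    rw [cyc_of_eq h]
    have : (A ++ [v]).length + j - k = A.length := by simp; omega
    rw [this] at hu
    obtain rfl : v = u := by simpa using hu
    exact hv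

theorem cyc_pow_zero (hk : 0 < k) (a : Fin k) : (cyc k ^ (a : ℕ)) ⟨0, hk⟩ = a := by
  obtain ⟨a, ha⟩ := a
  induction a with
  | zero => simp
  | succ n ih =>
    rw [pow_succ', Equiv.Perm.mul_apply]
    simp only at ih ⊢
    rw [ih (by omega), cyc_val_of_lt (by simpa using ha)]

variable [DecidableEq V] {E : Finset (Finset V)}

/-- A list whose entries lie in the classes listed by a permutation spans an edge. -/
theorem IsCompletePartite.toFinset_mem_s7 (hK : IsCompletePartite k E Vc) {w : List V}
    (hw : w.length = k) (f : Equiv.Perm (Fin k))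
    (hf : ∀ t : Fin k, w[(t : ℕ)]'(by omega) ∈ Vc (f t)) : w.toFinset ∈ E := by
  have h := hK.2.2 (fun i => w[((f.symm i : Fin k) : ℕ)]'(by omega))
    (fun i => by simpa using hf (f.symm i))
  convert h using 1
  ext v
  simp only [List.mem_toFinset, Finset.mem_image, Finset.mem_univ, true_and]
  rw [List.mem_iff_getElem]
  constructor
  · rintro ⟨n, hn, rfl⟩
    exact ⟨f ⟨n, by omega⟩, by simp⟩
  · rintro ⟨i, rfl⟩
    exact ⟨_, _, rfl⟩

/-- Gluing a tight path with end of type `ρ` to a tight path whose first vertices follow `ρ`. -/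
theorem IsTightPath.append (hK : IsCompletePartite k E Vc) {A Q : List V}
    {ρ : Equiv.Perm (Fin k)} (hA : IsTightPath k E A) (hAe : hasEndType k Vc A ρ)
    (hQ : IsTightPath k E Q)
    (hQs : ∀ j : Fin k, (j : ℕ) + 1 < k → ∀ v ∈ Q[(j : ℕ)]?, v ∈ Vc (ρ j))
    (hd : List.Disjoint A Q) : IsTightPath k E (A ++ Q) := by
  refine ⟨List.nodup_append'.2 ⟨hA.1, hQ.1, hd⟩, fun i hi => ?_⟩
  rw [List.length_append] at hi
  by_cases h1 : i + k ≤ A.length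
  · have := hA.2 i h1
    rwa [List.drop_append_of_le_length (by omega), List.take_append_of_le_length (by simp; omega)]
  by_cases h2 : A.length ≤ i
  · have := hQ.2 (i - A.length) (by omega)
    rwa [List.drop_append, List.drop_eq_nil_of_le h2, List.nil_append]
  push Not at h1 h2
  have : NeZero k := ⟨by omega⟩
  let c : Fin k := ⟨i + k - A.length, by omega⟩
  refine hK.toFinset_mem_s7 (by simp; omega) ((Equiv.addRight c).trans ρ) fun t => ?_
  have ht := t.2
  have hval : ((t + c : Fin k) : ℕ) = (t + (i + k - A.length)) % k := Fin.val_add t c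
  simp only [List.getElem_take, List.getElem_drop, Equiv.trans_apply, Equiv.coe_addRight]
  by_cases h3 : i + t < A.length
  · rw [List.getElem_append_left h3]
    rw [Nat.mod_eq_of_lt (by omega)] at hval
    refine hAe.2 (t + c) (by omega) _ ?_
    rw [Option.mem_def, List.getElem?_eq_some_iff]
    exact ⟨by omega, by congr 1; omega⟩
  · rw [List.getElem_append_right (by omega)]
    rw [Nat.mod_eq_sub_mod (by omega), Nat.mod_eq_of_lt (by omega)] at hval
    refine hQs (t + c) (by omega) _ ?_
    rw [Option.mem_def, List.getElem?_eq_some_iff]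
    exact ⟨by omega, by congr 1; omega⟩

end Extension

section Gadgets

variable {V : Type} [DecidableEq V] {k : ℕ} {E : Finset (Finset V)}
  {Vc : Fin k → Finset V} {G : SimpleGraph (Fin k)} {W : Fin k → Fin k → Finset V} {P : List V}

/-- `Q` extends `P` to a tight path with end of type `ρ`, using exactly the gadgets of the edges
in `F`; the classes in `X` lose one vertex and those in `Y` gain one relative to `2|F|`. -/
structure GadgetExtension (k : ℕ) (E : Finset (Finset V)) (Vc : Fin k → Finset V)
    (G : SimpleGraph (Fin k)) (W : Fin k → Fin k → Finset V) (P Q : List V)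
    (F : Finset (Sym2 (Fin k))) (ρ : Equiv.Perm (Fin k)) (X Y : Finset (Fin k)) : Prop where
  tight : IsTightPath k E (P ++ Q)
  endType : hasEndType k Vc (P ++ Q) ρ
  length : Q.length = 2 * k * F.card + Y.card
  subset : ↑F ⊆ G.edgeSet
  avoid : ∀ i j, G.Adj i j → s(i, j) ∉ F → Disjoint (W i j) (P ++ Q).toFinset
  count : ∀ i, (Vc i ∩ Q.toFinset).card + (if i ∈ X then 1 else 0) =
    2 * F.card + (if i ∈ Y then 1 else 0)
  outer : ∀ v, (v ∈ Q ∧ v ∉ univ.biUnion Vc) ↔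
    ∃ i j, s(i, j) ∈ F ∧ v ∈ W i j ∧ v ∉ univ.biUnion Vc

theorem GadgetExtension.nil (hP : IsTightPath k E P) (hPend : hasEndType k Vc P 1)
    (hW : IsGadget k E Vc G P.toFinset W) : GadgetExtension k E Vc G W P [] ∅ 1 ∅ ∅ where
  tight := by simpa using hP
  endType := by simpa using hPend
  length := by simp
  subset := by simp
  avoid i j h _ := by simpa using (hW.2.1 i j h).2.2.1
  count := by simp
  outer := by simp

/-- Every class has a vertex avoiding the path and all unused gadgets. -/
theorem GadgetExtension.exists_fresh {Q : List V} {F : Finset (Sym2 (Fin k))}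
    {ρ : Equiv.Perm (Fin k)} {X Y : Finset (Fin k)}
    (h : GadgetExtension k E Vc G W P Q F ρ X Y) (hW : IsGadget k E Vc G P.toFinset W)
    (hspace : ∀ i, 2 * G.edgeSet.ncard + 2 ≤ (Vc i \ P.toFinset).card) (i : Fin k) :
    ∃ v ∈ Vc i, v ∉ P ++ Q ∧ ∀ a b, G.Adj a b → s(a, b) ∉ F → v ∉ W a b := by
  classical
  set D := G.edgeSet.toFinite.toFinset with hD
  have hcard : G.edgeSet.ncard = D.card := Set.ncard_eq_toFinset_card _ _
  have hFD : F ⊆ D := fun e he => by simpa [hD] using h.subset he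
  let B := (D \ F).biUnion fun e => W e.out.1 e.out.2 ∩ Vc i
  have hB : B.card ≤ (D \ F).card * 2 := by
    refine card_biUnion_le_card_mul _ _ _ fun e he => ?_
    have hadj : G.Adj e.out.1 e.out.2 := by
      have : e ∈ G.edgeSet := by simpa [hD] using (mem_sdiff.1 he).1
      rw [← G.mem_edgeSet]
      have h2 : s(e.out.1, e.out.2) = e := Quot.out_eq e
      rwa [h2]
    rw [(hW.2.1 _ _ hadj).2.2.2.1 i]
    split_ifs <;> omega
  have hcnt := h.count i
  have hle := card_le_card hFD
  rw [card_sdiff_of_subset hFD] at hB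
  have hlt : ((Vc i ∩ Q.toFinset) ∪ B).card < (Vc i \ P.toFinset).card := by
    have h1 := card_union_le (Vc i ∩ Q.toFinset) B
    have h2 := hspace i
    have h3 : (if i ∈ Y then 1 else 0) ≤ 1 := by split_ifs <;> omega
    omega
  obtain ⟨v, hv, hvn⟩ := exists_mem_notMem_of_card_lt_card hlt
  simp only [mem_sdiff, List.mem_toFinset, mem_union, mem_inter, not_or, not_and] at hv hvn
  refine ⟨v, hv.1, by simp [hv.2, hvn.1 hv.1], fun a b hab hF hvW => hvn.2 ?_⟩
  refine mem_biUnion.2 ⟨s(a, b), mem_sdiff.2 ⟨by simpa [hD] using hab, hF⟩,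
    mem_inter.2 ⟨?_, hv.1⟩⟩
  have h2 : s((s(a, b)).out.1, (s(a, b)).out.2) = s(a, b) := Quot.out_eq _
  rcases Sym2.eq_iff.1 h2 with ⟨h3, h4⟩ | ⟨h3, h4⟩
  · rwa [h3, h4]
  · rwa [h3, h4, ← hW.1 a b hab]

theorem card_inter_toFinset_append (S : Finset V) {A B : List V} (h : List.Disjoint A B) :
    (S ∩ (A ++ B).toFinset).card = (S ∩ A.toFinset).card + (S ∩ B.toFinset).card := by
  rw [List.toFinset_append, inter_union_distrib_left, card_union_of_disjoint]
  rw [disjoint_left]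
  intro v hv hv'
  simp only [mem_inter, List.mem_toFinset] at hv hv'
  exact h hv.2 hv'.2

theorem IsCompletePartite.card_inter_singleton (hK : IsCompletePartite k E Vc) {i j : Fin k}
    {v : V} (hv : v ∈ Vc j) : (Vc i ∩ [v].toFinset).card = if i = j then 1 else 0 := by
  split_ifs with h
  · subst h
    rw [inter_eq_right.2 (by simpa using hv)]
    simp
  · rw [card_eq_zero, eq_empty_iff_forall_notMem]
    intro u hu
    simp only [mem_inter, List.mem_toFinset, List.mem_singleton] at hu
    exact disjoint_left.1 (hK.2.1 i j h) hu.1 (hu.2 ▸ hv)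

theorem isTightPath_singleton (hk : 1 < k) (v : V) : IsTightPath k E [v] :=
  ⟨by simp, fun i hi => by simp at hi; omega⟩

theorem IsTightPath.concat (hK : IsCompletePartite k E Vc) (hk : 1 < k) {A : List V} {v : V}
    {ρ : Equiv.Perm (Fin k)} (hA : IsTightPath k E A) (hAe : hasEndType k Vc A ρ)
    (hv : v ∈ Vc (ρ ⟨0, by omega⟩)) (hvA : v ∉ A) : IsTightPath k E (A ++ [v]) := by
  refine hA.append hK hAe (isTightPath_singleton hk v) (fun j _ u hu => ?_) (by simpa using hvA)
  rcases j with ⟨_ | j, hj⟩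
  · obtain rfl : v = u := by simpa using hu
    exact hv
  · simp at hu

/-- Append one vertex of the class missing from the end of the path. -/
theorem GadgetExtension.rotate (hk : 1 < k) (hK : IsCompletePartite k E Vc) {Q : List V}
    {F : Finset (Sym2 (Fin k))} {ρ : Equiv.Perm (Fin k)} {X Y : Finset (Fin k)}
    (h : GadgetExtension k E Vc G W P Q F ρ X Y) (hW : IsGadget k E Vc G P.toFinset W)
    (hspace : ∀ i, 2 * G.edgeSet.ncard + 2 ≤ (Vc i \ P.toFinset).card)
    (hY : ρ ⟨0, by omega⟩ ∉ Y) :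
    ∃ Q', GadgetExtension k E Vc G W P Q' F (ρ * cyc k) X (insert (ρ ⟨0, by omega⟩) Y) := by
  obtain ⟨v, hv, hvP, hvW⟩ := h.exists_fresh hW hspace (ρ ⟨0, by omega⟩)
  have hvQ : v ∉ Q := fun h => hvP (by simp [h])
  refine ⟨Q ++ [v], ?_, ?_, ?_, h.subset, ?_, ?_, ?_⟩
  · rw [← List.append_assoc]
    exact h.tight.concat hK hk h.endType hv hvP
  · rw [← List.append_assoc]
    exact h.endType.concat (by omega) hv
  · simp [h.length, card_insert_of_notMem hY]
    omega
  · intro i j hij hF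
    rw [← List.append_assoc, List.toFinset_append, disjoint_union_right]
    exact ⟨h.avoid i j hij hF, by simpa using hvW i j hij hF⟩
  · intro i
    rw [card_inter_toFinset_append _ (by simpa using hvQ), hK.card_inter_singleton hv]
    have := h.count i
    by_cases hi : i = ρ ⟨0, by omega⟩
    · rw [← hi] at hY ⊢
      simp only [hY, if_true, if_false, mem_insert, true_or] at this ⊢
      omega
    · simp only [hi, if_false, mem_insert, false_or] at this ⊢
      omega
  · intro u
    rw [← h.outer u]
    simp only [List.mem_append, List.mem_singleton]
    constructor
    · rintro ⟨hu | rfl, hn⟩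
      · exact ⟨hu, hn⟩
      · exact absurd (mem_biUnion.2 ⟨_, mem_univ _, hv⟩) hn
    · exact fun hu => ⟨Or.inl hu.1, hu.2⟩

/-- Traverse an unused gadget, composing the end type with a transposition. -/
theorem GadgetExtension.swap (hk : 1 < k) (hK : IsCompletePartite k E Vc) {Q : List V}
    {F : Finset (Sym2 (Fin k))} {ρ : Equiv.Perm (Fin k)} {X Y : Finset (Fin k)}
    (h : GadgetExtension k E Vc G W P Q F ρ X Y) (hW : IsGadget k E Vc G P.toFinset W)
    (hspace : ∀ i, 2 * G.edgeSet.ncard + 2 ≤ (Vc i \ P.toFinset).card)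
    {a b : Fin k} (hb : ρ ⟨0, by omega⟩ = b) (hab : G.Adj a b) (hF : s(a, b) ∉ F) (hX : a ∉ X) :
    ∃ Q', GadgetExtension k E Vc G W P Q' (insert s(a, b) F) (Equiv.swap a b * ρ)
      (insert a X) Y := by
  obtain ⟨v, hv, hvP, hvW⟩ := h.exists_fresh hW hspace b
  have hvQ : v ∉ Q := fun h => hvP (by simp [h])
  obtain ⟨hWcard, -, -, hWV, hWpath⟩ := hW.2.1 a b hab
  obtain ⟨R, hR, hRW, hRs, hRe⟩ := hWpath ρ ⟨⟨0, by omega⟩, rfl, Or.inr hb⟩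
  have hRlen : R.length = 2 * k - 1 := by
    rw [← hWcard, ← hRW, List.toFinset_card_of_nodup hR.1]
  have hmemR : ∀ u, u ∈ R ↔ u ∈ W a b := fun u => by rw [← hRW, List.mem_toFinset]
  have hdis : List.Disjoint (P ++ Q ++ [v]) R := by
    intro u hu hu'
    rw [hmemR] at hu'
    rcases List.mem_append.1 hu with hu | hu
    · exact disjoint_left.1 (h.avoid a b hab hF) hu' (by simpa using hu)
    · obtain rfl : u = v := by simpa using hu
      exact hvW a b hab hF hu'
  have hdis' : List.Disjoint (Q ++ [v]) R := fun u hu => hdis (by simp at hu ⊢; tauto)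
  have hassoc : P ++ (Q ++ [v] ++ R) = P ++ Q ++ [v] ++ R := by simp
  subst hb
  refine ⟨Q ++ [v] ++ R, ?_, ?_, ?_, ?_, ?_, ?_, ?_⟩
  · rw [hassoc]
    exact (h.tight.concat hK hk h.endType hv hvP).append hK (h.endType.concat (by omega) hv) hR
      hRs.2 hdis
  · rw [hassoc]
    exact hRe.append_left _
  · simp only [List.length_append, h.length, hRlen, card_insert_of_notMem hF, List.length_singleton,
      mul_add]
    omega
  · rw [coe_insert, Set.insert_subset_iff]
    exact ⟨hab, h.subset⟩
  · intro i j hij hiF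
    rw [mem_insert, not_or] at hiF
    rw [hassoc, List.toFinset_append, List.toFinset_append, disjoint_union_right,
      disjoint_union_right, hRW]
    refine ⟨⟨h.avoid i j hij hiF.2, by simpa using hvW i j hij hiF.2⟩,
      hW.2.2 i j a _ hij hab fun he => hiF.1 ?_⟩
    have he' : ({i, j} : Set (Fin k)) = {a, ρ ⟨0, by omega⟩} := by
      simpa using congrArg (fun s : Finset (Fin k) => (s : Set (Fin k))) he
    rw [Sym2.eq_iff]
    exact Set.pair_eq_pair_iff.1 he'
  · intro i
    rw [card_inter_toFinset_append _ hdis', card_inter_toFinset_append _ (by simpa using hvQ),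
      hK.card_inter_singleton hv, hRW, inter_comm _ (W _ _), hWV i, card_insert_of_notMem hF]
    have hne := hab.ne
    have := h.count i
    by_cases hi : i = a
    · subst hi
      simp only [hX, hne, if_true, if_false, mem_insert, true_or] at this ⊢
      omega
    · simp only [hi, mem_insert, false_or] at this ⊢
      split_ifs at this ⊢ <;> omega
  · intro u
    have ho := h.outer u
    constructor
    · rintro ⟨hu, hn⟩
      simp only [List.mem_append, List.mem_singleton] at hu
      rcases hu with (hu | rfl) | hu
      · obtain ⟨i, j, hij, hr⟩ := ho.1 ⟨hu, hn⟩
        exact ⟨i, j, mem_insert_of_mem hij, hr⟩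
      · exact absurd (mem_biUnion.2 ⟨_, mem_univ _, hv⟩) hn
      · exact ⟨a, _, mem_insert_self _ _, (hmemR u).1 hu, hn⟩
    · rintro ⟨i, j, hij, hu, hn⟩
      refine ⟨?_, hn⟩
      rw [List.mem_append, List.mem_append]
      rcases mem_insert.1 hij with he | he
      · refine Or.inr ((hmemR u).2 ?_)
        rcases Sym2.eq_iff.1 he with ⟨rfl, rfl⟩ | ⟨rfl, rfl⟩
        · exact hu
        · rwa [hW.1 _ _ hab]
      · exact Or.inl (Or.inl (ho.2 ⟨i, j, he, hu, hn⟩).1)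

/-- The images under `π` of the first `n` elements of `Fin k`. -/
def initialImage (π : Equiv.Perm (Fin k)) (n : ℕ) : Finset (Fin k) :=
  (univ.filter fun j : Fin k => (j : ℕ) < n).image π

theorem mem_initialImage {π : Equiv.Perm (Fin k)} {n : ℕ} {i : Fin k} :
    i ∈ initialImage π n ↔ ∃ j : Fin k, (j : ℕ) < n ∧ π j = i := by
  simp [initialImage]

theorem card_initialImage (π : Equiv.Perm (Fin k)) {n : ℕ} (hn : n ≤ k) :
    (initialImage π n).card = n := by
  rw [initialImage, card_image_of_injective _ π.injective, Fin.card_filter_val_lt]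
  omega

theorem initialImage_succ (π : Equiv.Perm (Fin k)) {n : ℕ} (hn : n < k) :
    initialImage π (n + 1) = insert (π ⟨n, hn⟩) (initialImage π n) := by
  ext i
  rw [mem_insert, mem_initialImage, mem_initialImage]
  constructor
  · rintro ⟨j, hj, rfl⟩
    rcases Nat.lt_succ_iff_lt_or_eq.1 hj with h | h
    · exact Or.inr ⟨j, h, rfl⟩
    · exact Or.inl (congrArg π (Fin.ext h))
  · rintro (rfl | ⟨j, hj, rfl⟩)
    · exact ⟨_, Nat.lt_succ_self n, rfl⟩
    · exact ⟨j, by omega, rfl⟩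

theorem GadgetExtension.rotate_pow (hk : 1 < k) (hK : IsCompletePartite k E Vc)
    {F : Finset (Sym2 (Fin k))} {π : Equiv.Perm (Fin k)} {X : Finset (Fin k)}
    (hW : IsGadget k E Vc G P.toFinset W)
    (hspace : ∀ i, 2 * G.edgeSet.ncard + 2 ≤ (Vc i \ P.toFinset).card) {a b : ℕ} (hab : a ≤ b)
    (hbk : b ≤ k)
    (h : ∃ Q, GadgetExtension k E Vc G W P Q F (π * cyc k ^ a) X (initialImage π a)) :
    ∃ Q, GadgetExtension k E Vc G W P Q F (π * cyc k ^ b) X (initialImage π b) := by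
  induction b, hab using Nat.le_induction with
  | base => exact h
  | succ n _ ih =>
    obtain ⟨Q, hQ⟩ := ih (by omega)
    have h0 : (π * cyc k ^ n) ⟨0, by omega⟩ = π ⟨n, by omega⟩ := by
      rw [Equiv.Perm.mul_apply]
      exact congrArg π (cyc_pow_zero (by omega) ⟨n, by omega⟩)
    have := hQ.rotate hk hK hW hspace (by
      rw [h0, mem_initialImage]
      rintro ⟨j, hj, hjn⟩
      rw [π.injective hjn] at hj
      simp at hj)
    rwa [h0, ← initialImage_succ, mul_assoc, ← pow_succ] at this

/-- The edges of the path with vertex list `l`. -/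
def pathEdges (l : List (Fin k)) : Finset (Sym2 (Fin k)) :=
  ((l.zip l.tail).map fun p => s(p.1, p.2)).toFinset

theorem pathEdges_cons_cons (a b : Fin k) (l : List (Fin k)) :
    pathEdges (a :: b :: l) = insert s(a, b) (pathEdges (b :: l)) := by
  simp [pathEdges]

theorem mem_of_mem_pathEdges {l : List (Fin k)} {e : Sym2 (Fin k)} (he : e ∈ pathEdges l)
    {x : Fin k} (hx : x ∈ e) : x ∈ l := by
  simp only [pathEdges, List.mem_toFinset, List.mem_map, Prod.exists] at he
  obtain ⟨a, b, hab, rfl⟩ := he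
  have := List.of_mem_zip hab
  rcases Sym2.mem_iff.1 hx with rfl | rfl
  · exact this.1
  · exact List.mem_of_mem_tail this.2

/-- Traverse the gadgets along a path, composing the end type with a cycle. -/
theorem GadgetExtension.formPerm (hk : 1 < k) (hK : IsCompletePartite k E Vc)
    {F : Finset (Sym2 (Fin k))} {ρ : Equiv.Perm (Fin k)} {X Y : Finset (Fin k)}
    (hW : IsGadget k E Vc G P.toFinset W)
    (hspace : ∀ i, 2 * G.edgeSet.ncard + 2 ≤ (Vc i \ P.toFinset).card)
    (h : ∃ Q, GadgetExtension k E Vc G W P Q F ρ X Y) (l : List (Fin k)) (hl : l.Nodup)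
    (hlast : ρ ⟨0, by omega⟩ ∈ l.getLast?) (hG : ↑(pathEdges l) ⊆ G.edgeSet)
    (hF : Disjoint F (pathEdges l)) (hX : ∀ x ∈ l.dropLast, x ∉ X) :
    ∃ Q, GadgetExtension k E Vc G W P Q (F ∪ pathEdges l) (l.formPerm * ρ)
      (X ∪ l.dropLast.toFinset) Y := by
  induction l with
  | nil => simp at hlast
  | cons a l ih =>
    cases l with
    | nil => simpa [pathEdges] using h
    | cons b l =>
      rw [pathEdges_cons_cons] at hF hG ⊢
      rw [coe_insert, Set.insert_subset_iff] at hG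
      rw [disjoint_insert_right] at hF
      have hlast' : ρ ⟨0, by omega⟩ ∈ (b :: l).getLast? := by simpa using hlast
      rw [List.dropLast_cons_cons] at hX ⊢
      obtain ⟨Q, hQ⟩ := ih hl.of_cons hlast' hG.2 hF.2
        (fun x hx => hX x (List.mem_cons_of_mem _ hx))
      have ha : a ∉ b :: l := (List.nodup_cons.1 hl).1
      have hb : ((b :: l).formPerm * ρ) ⟨0, by omega⟩ = b := by
        rw [List.getLast?_eq_some_getLast (by simp), Option.mem_some_iff] at hlast'
        rw [Equiv.Perm.mul_apply, ← hlast', List.formPerm_apply_getLast]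
      have := hQ.swap hk hK hW hspace hb hG.1
        (by
          rw [mem_union, not_or]
          exact ⟨hF.1, fun he => ha (mem_of_mem_pathEdges he (Sym2.mem_mk_left a b))⟩)
        (by
          rw [mem_union, not_or, List.mem_toFinset]
          exact ⟨hX a List.mem_cons_self, fun h => ha (List.mem_of_mem_dropLast h)⟩)
      rwa [List.formPerm_cons_cons, mul_assoc, List.toFinset_cons, union_insert, union_insert]

/-- The edges of all the paths in `L`. -/
def pathsEdges (L : List (List (Fin k))) : Finset (Sym2 (Fin k)) :=
  L.toFinset.biUnion pathEdges

theorem mem_pathsEdges {L : List (List (Fin k))} {e : Sym2 (Fin k)} :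
    e ∈ pathsEdges L ↔ ∃ l ∈ L, e ∈ pathEdges l := by
  simp [pathsEdges]

theorem not_isDiag_of_mem_pathEdges {l : List (Fin k)} (hl : l.Nodup) {e : Sym2 (Fin k)}
    (he : e ∈ pathEdges l) : ¬ e.IsDiag := by
  induction l with
  | nil => simp [pathEdges] at he
  | cons a l ih =>
    cases l with
    | nil => simp [pathEdges] at he
    | cons b l =>
      rw [pathEdges_cons_cons, mem_insert] at he
      rcases he with rfl | he
      · rw [Sym2.mk_isDiag_iff]
        exact fun hab => (List.nodup_cons.1 hl).1 (hab ▸ List.mem_cons_self)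
      · exact ih hl.of_cons he

theorem edgeSet_pathsGraph {L : List (List (Fin k))} (hL : ∀ l ∈ L, l.Nodup) :
    (pathsGraph k L).edgeSet = ↑(pathsEdges L) := by
  ext e
  rw [pathsGraph, SimpleGraph.edgeSet_fromEdgeSet, mem_coe, mem_pathsEdges]
  have hiff : (∃ l ∈ L, ∃ p ∈ l.zip l.tail, e = s(p.1, p.2)) ↔ ∃ l ∈ L, e ∈ pathEdges l := by
    simp only [pathEdges, List.mem_toFinset, List.mem_map, eq_comm]
  rw [Set.mem_sdiff, Set.mem_ofPred_eq, hiff]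
  refine ⟨fun h => h.1, fun h => ⟨h, ?_⟩⟩
  obtain ⟨l, hl, he⟩ := h
  exact not_isDiag_of_mem_pathEdges (hL l hl) he

theorem prod_formPerm_apply_of_notMem {L : List (List (Fin k))} {x : Fin k}
    (hx : ∀ l ∈ L, x ∉ l) : (L.map List.formPerm).prod x = x := by
  induction L with
  | nil => simp
  | cons l L ih =>
    simp only [List.map_cons, List.prod_cons, Equiv.Perm.mul_apply]
    rw [ih fun l' hl' => hx l' (List.mem_cons_of_mem _ hl'),
      List.formPerm_apply_of_notMem (hx l List.mem_cons_self)]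

theorem mOf_concat {L : List (List (Fin k))} {l : List (Fin k)} {M : Fin k}
    (hM : M ∈ l.getLast?) : mOf k (L ++ [l]) = M + 1 := by
  rw [Option.mem_def] at hM
  simp [mOf, hM]

/-- Traverse all gadgets of a normalized cycle decomposition. -/
theorem exists_gadgetExtension (hk : 1 < k) (hK : IsCompletePartite k E Vc)
    (hP : IsTightPath k E P) (hPend : hasEndType k Vc P 1)
    (hW : IsGadget k E Vc G P.toFinset W)
    (hspace : ∀ i, 2 * G.edgeSet.ncard + 2 ≤ (Vc i \ P.toFinset).card)
    (L : List (List (Fin k))) (σ : Equiv.Perm (Fin k)) (hL : IsNormCycleDecomp k σ L)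
    (hG : ↑(pathsEdges L) ⊆ G.edgeSet) :
    mOf k L ≤ k ∧ ∃ Q, GadgetExtension k E Vc G W P Q (pathsEdges L) (σ * cyc k ^ (mOf k L - 1))
      (L.toFinset.biUnion fun l => l.dropLast.toFinset) (initialImage σ (mOf k L - 1)) := by
  induction L using List.reverseRecOn generalizing σ with
  | nil =>
    obtain rfl : σ = 1 := by simpa using hL.2.2.1
    refine ⟨by simp [mOf]; omega, [], ?_⟩
    simpa [mOf, pathsEdges, initialImage] using GadgetExtension.nil hP hPend hW
  | append_singleton L l ih =>
    obtain ⟨h1, h2, rfl, h4, h5⟩ := hL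
    rw [List.pairwise_append] at h2 h5
    have hmem : ∀ l' ∈ L, l' ∈ L ++ [l] := fun l' h => List.mem_append_left _ h
    have hlm : l ∈ L ++ [l] := by simp
    have hdj : ∀ x ∈ l, ∀ l' ∈ L, x ∉ l' :=
      fun x hx l' hl' hx' => h2.2.2 l' hl' l (by simp) x hx' x hx rfl
    obtain ⟨hm, hQ⟩ := ih _ ⟨fun l' h => h1 l' (hmem l' h), h2.1, rfl,
      fun l' h => h4 l' (hmem l' h), h5.1⟩ fun e he => hG (by
        obtain ⟨l', hl', he⟩ := mem_pathsEdges.1 he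
        exact mem_pathsEdges.2 ⟨l', hmem l' hl', he⟩)
    set π := (L.map List.formPerm).prod with hπ
    have hne : l ≠ [] := by
      rintro rfl
      simpa using (h1 _ hlm).1
    obtain ⟨M, hM⟩ : ∃ M, M ∈ l.getLast? := ⟨_, List.getLast?_eq_some_getLast hne⟩
    have hMl : M ∈ l := List.mem_of_mem_getLast? hM
    have hmM : mOf k L - 1 ≤ M := by
      rcases L.eq_nil_or_concat' with rfl | ⟨L', l', rfl⟩
      · simp [mOf]
      · have hne' : l' ≠ [] := by
          rintro rfl
          simpa using (h1 [] (by simp)).1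
        obtain ⟨M', hM'⟩ : ∃ M, M ∈ l'.getLast? := ⟨_, List.getLast?_eq_some_getLast hne'⟩
        rw [mOf_concat hM']
        have : M' < M := h5.2.2 l' (by simp) l (by simp) M' hM' M hM
        simpa using this.le
    rw [mOf_concat hM]
    have hMk := M.2
    refine ⟨hMk, ?_⟩
    have h0 : (π * cyc k ^ (M : ℕ)) ⟨0, by omega⟩ = M := by
      rw [Equiv.Perm.mul_apply, cyc_pow_zero]
      exact prod_formPerm_apply_of_notMem (hdj M hMl)
    have hcomm : Commute l.formPerm π := by
      refine Equiv.Perm.Disjoint.commute fun x => ?_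
      by_cases hx : x ∈ l
      · exact Or.inr (prod_formPerm_apply_of_notMem (hdj x hx))
      · exact Or.inl (List.formPerm_apply_of_notMem hx)
    have hY : initialImage π M = initialImage (π * l.formPerm) M := by
      refine image_congr fun c hc => ?_
      have hc : c < M := by simpa using hc
      rw [Equiv.Perm.mul_apply, List.formPerm_apply_of_notMem]
      exact fun hcl => absurd (h4 l hlm M hM c hcl) (not_le.2 hc)
    have key := GadgetExtension.formPerm hk hK hW hspace
      (GadgetExtension.rotate_pow hk hK hW hspace hmM hMk.le hQ) l (h1 l hlm).2 (by rwa [h0])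
      (fun e he => hG (mem_pathsEdges.2 ⟨l, hlm, he⟩))
      (by
        rw [disjoint_left]
        intro e he he'
        obtain ⟨l', hl', he⟩ := mem_pathsEdges.1 he
        obtain ⟨x, hx⟩ : ∃ x, x ∈ e := ⟨_, Sym2.out_fst_mem e⟩
        exact hdj x (mem_of_mem_pathEdges he' hx) l' hl' (mem_of_mem_pathEdges he hx))
      (by
        intro x hx hx'
        obtain ⟨l', hl', hx'⟩ := mem_biUnion.1 hx'
        exact hdj x (List.mem_of_mem_dropLast hx) l' (by simpa using hl')
          (List.mem_of_mem_dropLast (by simpa using hx')))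
    rw [← mul_assoc, hcomm.eq, hY] at key
    simpa only [pathsEdges, List.toFinset_append, union_biUnion, List.toFinset_cons,
      List.toFinset_nil, insert_empty_eq, singleton_biUnion, List.map_append, List.prod_append,
      List.map_cons, List.map_nil, List.prod_singleton, add_tsub_cancel_right] using key

theorem IsGadget.deleteEdges {S S' : Finset V} (hW : IsGadget k E Vc G S W)
    (F : Set (Sym2 (Fin k)))
    (hS : ∀ i j, G.Adj i j → s(i, j) ∉ F → Disjoint (W i j) S') :
    IsGadget k E Vc (G.deleteEdges F) S' W := by
  simp only [IsGadget, SimpleGraph.deleteEdges_adj]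
  refine ⟨fun i j h => hW.1 i j h.1, fun i j h => ?_,
    fun i j i' j' h h' => hW.2.2 i j i' j' h.1 h'.1⟩
  obtain ⟨h1, h2, -, h4⟩ := hW.2.1 i j h.1
  exact ⟨h1, h2, hS i j h.1 h.2, h4⟩

end Gadgets

/-- extending a tight path with end of type `id` to one with end of type
`σ τ^{m(σ)-1}`, using a `G`-gadget where `G ⊇ G_σ`.  The normalized cyclic decomposition
of `σ` is given as the list of lists `L`; `G_σ = pathsGraph k L` and `m(σ) = mOf k L`. -/
theorem gadget_sigma {V : Type} [Fintype V] [DecidableEq V] (k : ℕ) (hk : 3 ≤ k)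
    (E : Finset (Finset V)) (hE : IsKGraph k E)
    (Vc : Fin k → Finset V) (hK : IsCompletePartite k E Vc)
    (P : List V) (hP : IsTightPath k E P) (hPend : hasEndType k Vc P 1)
    (σ : Equiv.Perm (Fin k)) (L : List (List (Fin k))) (hL : IsNormCycleDecomp k σ L)
    (G : SimpleGraph (Fin k)) (hGs : pathsGraph k L ≤ G)
    (W : Fin k → Fin k → Finset V) (hW : IsGadget k E Vc G P.toFinset W)
    (hspace : ∀ i : Fin k, 2 * G.edgeSet.ncard + 2 ≤ ((Vc i) \ P.toFinset).card) :
    ∃ P' Q' : List V, P' = P ++ Q' ∧ IsTightPath k E P' ∧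
      hasEndType k Vc P' (σ * (cyc k) ^ (mOf k L - 1)) ∧
      P'.length = P.length + 2 * k * (pathsGraph k L).edgeSet.ncard + (mOf k L - 1) ∧
      (∀ i : Fin k, (Vc i ∩ (P'.toFinset \ P.toFinset)).card =
        2 * (pathsGraph k L).edgeSet.ncard
          - (if ∃ l ∈ L, i ∈ l.dropLast then 1 else 0)
          + (if ∃ j : Fin k, (j : ℕ) < mOf k L - 1 ∧ σ j = i then 1 else 0)) ∧
      (∃ W' : Fin k → Fin k → Finset V,
        IsGadget k E Vc (G.deleteEdges (pathsGraph k L).edgeSet) P'.toFinset W') ∧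
      P'.toFinset \ (P.toFinset ∪ Finset.univ.biUnion Vc) =
        gadgetVerts k Vc (pathsGraph k L) W := by
  have hnd : ∀ l ∈ L, l.Nodup := fun l hl => (hL.1 l hl).2
  have hedge := edgeSet_pathsGraph hnd
  obtain ⟨hm, Q, hQ⟩ := exists_gadgetExtension (by omega) hK hP hPend hW hspace L σ hL
    (hedge ▸ SimpleGraph.edgeSet_mono hGs)
  have hdis : List.Disjoint P Q := (List.nodup_append'.1 hQ.tight.1).2.2
  have hcard : (pathsGraph k L).edgeSet.ncard = (pathsEdges L).card := by
    rw [hedge, Set.ncard_coe_finset]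
  refine ⟨P ++ Q, Q, rfl, hQ.tight, hQ.endType, ?_, fun i => ?_, ⟨W, ?_⟩, ?_⟩
  · rw [List.length_append, hQ.length, hcard, card_initialImage _ (by omega), add_assoc]
  · have hsd : (P ++ Q).toFinset \ P.toFinset = Q.toFinset := by
      rw [List.toFinset_append, union_sdiff_cancel_left]
      rw [disjoint_left]
      exact fun v hv hv' => hdis (by simpa using hv) (by simpa using hv')
    have hX : (i ∈ L.toFinset.biUnion fun l => l.dropLast.toFinset) ↔
        ∃ l ∈ L, i ∈ l.dropLast := by simp
    have hcnt := hQ.count i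
    simp only [hX, mem_initialImage] at hcnt
    rw [hsd, hcard]
    have hpos : (∃ l ∈ L, i ∈ l.dropLast) → 0 < (pathsEdges L).card := by
      rintro ⟨l, hl, -⟩
      obtain ⟨h2, -⟩ := hL.1 l hl
      refine card_pos.2 ?_
      match l, h2, hl with
      | a :: b :: l, _, hl =>
        exact ⟨s(a, b), mem_pathsEdges.2 ⟨_, hl, by simp [pathEdges_cons_cons]⟩⟩
    by_cases h1 : ∃ l ∈ L, i ∈ l.dropLast
    · have := hpos h1
      rw [if_pos h1] at hcnt ⊢
      omega
    · rw [if_neg h1] at hcnt ⊢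
      omega
  · rw [hedge]
    exact hW.deleteEdges _ fun i j hij hF => hQ.avoid i j hij (by simpa using hF)
  · ext v
    have ho := hQ.outer v
    have hadj : ∀ i j, (pathsGraph k L).Adj i j ↔ s(i, j) ∈ pathsEdges L := fun i j => by
      rw [← SimpleGraph.mem_edgeSet, hedge, mem_coe]
    simp only [gadgetVerts, mem_biUnion (s := filter _ _), mem_filter, mem_univ, true_and,
      Prod.exists, mem_sdiff, hadj]
    rw [show (∃ i j, s(i, j) ∈ pathsEdges L ∧ v ∈ W i j ∧ v ∉ univ.biUnion Vc) ↔ _ from ho.symm]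
    simp only [List.toFinset_append, mem_union, List.mem_toFinset, not_or]
    have := fun h : v ∈ P => @hdis v h
    tauto
end

section
/- Let k ≥ 3 be an integer, let σ and π be permutations of [k], and let 0 ≤ r < k. Then there exists a graph G = G(σ, π, r) on [k] that is a vertex-disjoint union of paths such that the following holds for every s ≥ k(2k−1) with s ≡ r (mod k): whenever H is a k-graph containing a complete (k,k)-graph K with vertex classes V₁,…,V_k, and P is a tight path in H with start of type σ and end of type π, such that K has a G-gadget W_G avoiding V(P) and |V_i ∖ V(P)| ≥ ⌊s/k⌋ + 1 for all 1 ≤ i ≤ k, there exists a tight cycle C in H on |V(P)| + s vertices containing P, with V(C) ∖ (V(P) ∪ V(K)) = { w_{ij} : ij ∈ E(G) }. Moreover, if σ = π, then for all 1 ≤ i, j ≤ k we have | |V_i ∩ (V(C) ∖ V(P))| − |V_j ∩ (V(C) ∖ V(P))| | ≤ 1. -/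
set_option autoImplicit false

open Finset

/-- A sorting of the permutation `μ` by transpositions: at step `e` the least moved position
`q e` is exchanged with its image under the current permutation `M e`. -/
structure SwapSort (k : ℕ) (μ : Equiv.Perm (Fin k)) where
  /-- the number of transpositions -/
  E : ℕ
  /-- the permutation that remains to be sorted -/
  M : ℕ → Equiv.Perm (Fin k)
  /-- the least position that is not yet sorted -/
  q : ℕ → Fin k
  init : M 0 = μ
  final : ∀ e, E ≤ e → M e = 1
  moved : ∀ e < E, M e (q e) ≠ q e
  below : ∀ e < E, ∀ x < q e, M e x = x
  step : ∀ e < E, M (e + 1) = M e * Equiv.swap (q e) (M e (q e))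
  bound : E = 0 ∨ E + 1 ≤ μ.support.card

theorem SwapSort.nonempty {k : ℕ} (hk : 0 < k) (μ : Equiv.Perm (Fin k)) :
    Nonempty (SwapSort k μ) := by
  induction hn : μ.support.card using Nat.strong_induction_on generalizing μ with
  | _ n ih =>
  by_cases hμ : μ = 1
  · subst hμ
    exact ⟨⟨0, fun _ => 1, fun _ => ⟨0, hk⟩, rfl, fun _ _ => rfl, by simp, by simp, by simp,
      Or.inl rfl⟩⟩
  · have hne : μ.support.Nonempty := by
      rw [Finset.nonempty_iff_ne_empty]; simpa using hμ
    obtain ⟨q, hq, hmin⟩ := Finset.exists_min_image μ.support id hne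
    rw [Equiv.Perm.mem_support] at hq
    have hsub : (μ * Equiv.swap q (μ q)).support ⊂ μ.support := by
      refine Finset.ssubset_iff_subset_ne.mpr ⟨fun x hx => ?_, fun h => ?_⟩
      · rw [Equiv.Perm.mem_support] at hx ⊢
        intro h
        apply hx
        have h1 : x ≠ q := by rintro rfl; exact hq h
        have h2 : x ≠ μ q := by rintro rfl; exact hq (μ.injective h)
        simp [Equiv.swap_apply_of_ne_of_ne h1 h2, h]
      · have : μ q ∈ μ.support := by simpa using hq
        rw [← h, Equiv.Perm.mem_support] at this
        simp at this
    have hlt := Finset.card_lt_card hsub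
    obtain ⟨S⟩ := ih _ (hn ▸ hlt) _ rfl
    refine ⟨⟨S.E + 1, fun e => Nat.casesOn e μ S.M, fun e => Nat.casesOn e q S.q, rfl,
      ?_, ?_, ?_, ?_, Or.inr ?_⟩⟩
    · rintro (_ | e) he
      · omega
      · exact S.final e (by omega)
    · rintro (_ | e) he
      · exact hq
      · exact S.moved e (by omega)
    · rintro (_ | e) he x hx
      · by_contra h
        exact absurd (hmin x (by simpa using h)) (not_le.mpr hx)
      · exact S.below e (by omega) x hx
    · rintro (_ | e) he
      · exact S.init
      · exact S.step e (by omega)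
    · have h2 : 2 ≤ μ.support.card := Equiv.Perm.two_le_card_support_of_ne_one hμ
      rcases S.bound with h | h <;> omega

namespace SwapSort

variable {k : ℕ} {μ : Equiv.Perm (Fin k)} (S : SwapSort k μ)

theorem E_lt (hk : 0 < k) : S.E < k := by
  have := Finset.card_le_univ μ.support
  rw [Fintype.card_fin] at this
  rcases S.bound with h | h <;> omega

theorem q_lt {e : ℕ} (he : e < S.E) : S.q e < S.M e (S.q e) := by
  refine lt_of_le_of_ne (not_lt.mp fun h => ?_) (S.moved e he).symm
  exact S.moved e he ((S.M e).injective (S.below e he _ h))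

theorem step_of_ne {e : ℕ} {x : Fin k} (h₁ : x ≠ S.q e)
    (h₂ : x ≠ S.M e (S.q e)) : S.M (e + 1) x = S.M e x := by
  rcases lt_or_ge e S.E with he | he
  · simp [S.step e he, Equiv.swap_apply_of_ne_of_ne h₁ h₂]
  · rw [S.final e he, S.final (e + 1) (by omega)]

theorem step_left {e : ℕ} (he : e < S.E) :
    S.M (e + 1) (S.q e) = S.M e (S.M e (S.q e)) := by
  simp [S.step e he]

theorem step_right {e : ℕ} (he : e < S.E) :
    S.M (e + 1) (S.M e (S.q e)) = S.M e (S.q e) := by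
  simp [S.step e he]

theorem fixed_succ {e : ℕ} {x : Fin k} (h : S.M e x = x) : S.M (e + 1) x = x := by
  rcases lt_or_ge e S.E with he | he
  · rw [S.step_of_ne, h]
    · rintro rfl; exact S.moved e he h
    · rintro rfl; exact S.moved e he ((S.M e).injective h)
  · rw [S.final (e + 1) (by omega)]; rfl

theorem fixed_mono {e e' : ℕ} (hee : e ≤ e') {x : Fin k} (h : S.M e x = x) :
    S.M e' x = x := by
  induction e', hee using Nat.le_induction with
  | base => exact h
  | succ n _ ih => exact S.fixed_succ ih

theorem q_mono {e e' : ℕ} (hee : e ≤ e') (he' : e' < S.E) : S.q e ≤ S.q e' :=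
  not_lt.mp fun h => S.moved e' he' (S.fixed_mono hee (S.below e (by omega) _ h))

theorem q_eq_of_least {e : ℕ} (he : e < S.E) {y : Fin k} (hy : S.M e y ≠ y)
    (hlt : ∀ z < y, S.M e z = z) : S.q e = y :=
  le_antisymm (not_lt.mp fun h => hy (S.below e he _ h))
    (not_lt.mp fun h => S.moved e he (hlt _ h))

/-- An element that starts to the right of its place is delayed at some step. -/
theorem exists_delay {x y : Fin k} (hxy : x < y) (h0 : μ y = x) :
    ∃ e < S.E, S.M (e + 1) (S.q e) = x := by
  by_contra! hno
  have key : ∀ e, S.M e y = x := by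
    intro e
    induction e with
    | zero => rw [S.init, h0]
    | succ e ih =>
      rcases lt_or_ge e S.E with he | he
      · rw [S.step_of_ne, ih]
        · rintro rfl
          exact absurd (S.q_lt he) (by rw [ih]; exact not_lt.mpr hxy.le)
        · intro hy
          exact hno e he (by rw [S.step_left he, ← hy, ih])
      · rw [S.final e he] at ih
        rw [S.final (e + 1) (by omega), ih]
  have := key S.E
  rw [S.final _ le_rfl] at this
  exact hxy.ne' this

theorem not_delay_of_lt {e e' : ℕ} {x : Fin k} (hee : e < e') (he' : e' < S.E)
    (h : S.M (e + 1) (S.q e) = x) : S.M (e' + 1) (S.q e') ≠ x := by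
  have key : S.M e' x = x ∨ ∃ y, S.M e' y = x ∧ ∀ z < y, S.M e' z = z := by
    induction e', hee using Nat.le_induction with
    | base =>
      exact Or.inr ⟨_, h, fun z hz => S.fixed_succ (S.below e (by omega) z hz)⟩
    | succ n hn ih =>
      rcases ih (by omega) with h1 | ⟨y, hy, hlt⟩
      · exact Or.inl (S.fixed_succ h1)
      · by_cases hxy : y = x
        · exact Or.inl (S.fixed_succ (hxy ▸ hy))
        · have hq := S.q_eq_of_least (by omega) (hy ▸ Ne.symm hxy) hlt
          subst hq
          left
          rw [← hy]
          exact S.step_right (by omega)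
  rw [S.step_left he']
  intro hx
  rcases key with h1 | ⟨y, hy, hlt⟩
  · have h2 : S.M e' (S.q e') = x := (S.M e').injective (hx.trans h1.symm)
    exact S.moved e' he' ((S.M e').injective (hx.trans h2.symm))
  · have hyx : y = S.M e' (S.q e') := (S.M e').injective (hy.trans hx.symm)
    exact absurd (S.q_lt he') (not_lt.mpr (not_lt.mp fun hlt' => S.moved e' he' (hlt _ (hyx ▸ hlt'))))

theorem delay_unique {e e' : ℕ} {x : Fin k} (he : e < S.E) (he' : e' < S.E)
    (h : S.M (e + 1) (S.q e) = x) (h' : S.M (e' + 1) (S.q e') = x) : e = e' := by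
  rcases lt_trichotomy e e' with hlt | heq | hlt
  · exact absurd h' (S.not_delay_of_lt hlt he' h)
  · exact heq
  · exact absurd h (S.not_delay_of_lt hlt he h')

theorem exists_path_lists (f : Equiv.Perm (Fin k)) {e : ℕ} (he : e ≤ S.E) :
    ∃ L : List (List (Fin k)), (∀ l ∈ L, l.Nodup) ∧
      L.Pairwise (fun l₁ l₂ => ∀ a ∈ l₁, ∀ b ∈ l₂, a ≠ b) ∧
      (∀ l ∈ L, ∀ x, f x ∈ l → S.M e x ≠ x) ∧
      (e < S.E → ∃ t L', L = (f (S.M e (S.q e)) :: t) :: L') ∧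
      ∀ z, (∃ l ∈ L, ∃ p ∈ l.zip l.tail, z = s(p.1, p.2)) ↔
        ∃ e', e ≤ e' ∧ e' < S.E ∧ z = s(f (S.M e' (S.q e')), f (S.M (e' + 1) (S.q e'))) := by
  induction he using Nat.decreasingInduction with
  | self =>
    refine ⟨[], by simp, by simp, by simp, by simp, fun z => ?_⟩
    simp only [List.not_mem_nil, false_and, exists_false, false_iff]
    rintro ⟨e', h1, h2, -⟩
    omega
  | of_succ e he ih =>
    obtain ⟨L, hnd, hpw, hmv, hhd, hed⟩ := ih
    have hsplit : ∀ z, (∃ e', e ≤ e' ∧ e' < S.E ∧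
        z = s(f (S.M e' (S.q e')), f (S.M (e' + 1) (S.q e')))) ↔
        z = s(f (S.M e (S.q e)), f (S.M (e + 1) (S.q e))) ∨ ∃ e', e + 1 ≤ e' ∧ e' < S.E ∧
          z = s(f (S.M e' (S.q e')), f (S.M (e' + 1) (S.q e'))) := by
      intro z
      constructor
      · rintro ⟨e', h1, h2, h3⟩
        rcases h1.eq_or_lt with rfl | h1
        · exact Or.inl h3
        · exact Or.inr ⟨e', h1, h2, h3⟩
      · rintro (h | ⟨e', h1, h2, h3⟩)
        · exact ⟨e, le_rfl, he, h⟩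
        · exact ⟨e', by omega, h2, h3⟩
    have hnew : ∀ l ∈ L, f (S.M e (S.q e)) ∉ l := fun l hl h => hmv l hl _ h (S.step_right he)
    have hmv' : ∀ l ∈ L, ∀ x, f x ∈ l → S.M e x ≠ x :=
      fun l hl x hx h => hmv l hl x hx (S.fixed_succ h)
    have hmoved : S.M e (S.M e (S.q e)) ≠ S.M e (S.q e) :=
      fun h => S.moved e he ((S.M e).injective h)
    by_cases hfix : S.M (e + 1) (S.q e) = S.q e
    · have hq : ∀ l ∈ L, f (S.q e) ∉ l := fun l hl h => hmv l hl _ h hfix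
      refine ⟨[f (S.M e (S.q e)), f (S.q e)] :: L, ?_, ?_, ?_, fun _ => ⟨_, _, rfl⟩, fun z => ?_⟩
      · intro l hl
        rcases List.mem_cons.mp hl with rfl | hl
        · simpa using S.moved e he
        · exact hnd l hl
      · refine List.pairwise_cons.mpr ⟨fun l hl a ha b hb hab => ?_, hpw⟩
        subst hab
        simp only [List.mem_cons, List.not_mem_nil, or_false] at ha
        rcases ha with rfl | rfl
        · exact hnew l hl hb
        · exact hq l hl hb
      · intro l hl x hx
        rcases List.mem_cons.mp hl with rfl | hl
        · simp only [List.mem_cons, List.not_mem_nil, or_false, f.injective.eq_iff] at hx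
          rcases hx with rfl | rfl
          · exact hmoved
          · exact S.moved e he
        · exact hmv' l hl x hx
      · rw [hsplit, ← hed, List.exists_mem_cons_iff, hfix]
        simp
    · have hlt : e + 1 < S.E := by
        by_contra h
        exact hfix (by rw [S.final (e + 1) (by omega)]; rfl)
      have hqq : S.q (e + 1) = S.q e :=
        S.q_eq_of_least hlt hfix fun z hz => S.fixed_succ (S.below e he z hz)
      obtain ⟨t, L', rfl⟩ := hhd hlt
      rw [hqq] at *
      refine ⟨(f (S.M e (S.q e)) :: f (S.M (e + 1) (S.q e)) :: t) :: L', ?_, ?_, ?_,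
        fun _ => ⟨_, _, rfl⟩, fun z => ?_⟩
      · intro l hl
        rcases List.mem_cons.mp hl with rfl | hl
        · exact List.nodup_cons.mpr ⟨hnew _ (by simp), hnd _ (by simp)⟩
        · exact hnd l (List.mem_cons_of_mem _ hl)
      · rw [List.pairwise_cons] at hpw ⊢
        refine ⟨fun l hl a ha b hb => ?_, hpw.2⟩
        rcases List.mem_cons.mp ha with rfl | ha
        · rintro rfl
          exact hnew l (List.mem_cons_of_mem _ hl) hb
        · exact hpw.1 l hl a ha b hb
      · intro l hl x hx
        rcases List.mem_cons.mp hl with rfl | hl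
        · rcases List.mem_cons.mp hx with hx | hx
          · rw [f.injective.eq_iff] at hx
            exact hx ▸ hmoved
          · exact hmv' _ (by simp) x hx
        · exact hmv' l (List.mem_cons_of_mem _ hl) x hx
      · rw [hsplit, ← hed, List.exists_mem_cons_iff, List.exists_mem_cons_iff]
        simp [or_assoc]

theorem exists_paths_graph (f : Equiv.Perm (Fin k)) :
    ∃ G : SimpleGraph (Fin k), IsUnionOfPaths k G ∧ ∀ i j, G.Adj i j ↔
      ∃ e < S.E, s(i, j) = s(f (S.M e (S.q e)), f (S.M (e + 1) (S.q e))) := by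
  obtain ⟨L, hnd, hpw, -, -, hed⟩ := S.exists_path_lists f (Nat.zero_le S.E)
  refine ⟨pathsGraph k L, ⟨L, hnd, hpw, rfl⟩, fun i j => ?_⟩
  rw [pathsGraph, SimpleGraph.fromEdgeSet_adj, Set.mem_ofPred_eq, hed]
  constructor
  · rintro ⟨⟨e, -, he, h⟩, -⟩
    exact ⟨e, he, h⟩
  · rintro ⟨e, he, h⟩
    refine ⟨⟨e, Nat.zero_le e, he, h⟩, ?_⟩
    rintro rfl
    have hd : (s(i, i) : Sym2 (Fin k)).IsDiag := rfl
    rw [h, Sym2.mk_isDiag_iff, f.injective.eq_iff, S.step_left he] at hd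
    exact S.moved e he ((S.M e).injective hd.symm)

theorem edge_ne {e e' : ℕ} (f : Equiv.Perm (Fin k)) (hee : e < e') (he' : e' < S.E) :
    ({f (S.M e (S.q e)), f (S.M (e + 1) (S.q e))} : Finset (Fin k)) ≠
      {f (S.M e' (S.q e')), f (S.M (e' + 1) (S.q e'))} := by
  intro h
  have hmem : f (S.M e (S.q e)) ∈
      ({f (S.M e' (S.q e')), f (S.M (e' + 1) (S.q e'))} : Finset (Fin k)) := h ▸ by simp
  have hfix := S.fixed_mono hee (S.step_right (hee.trans he'))
  have hq := S.moved e' he'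
  rw [Finset.mem_insert, Finset.mem_singleton, f.injective.eq_iff, f.injective.eq_iff,
    S.step_left he'] at hmem
  rcases hmem with h | h <;> rw [h] at hfix
  · exact hq ((S.M e').injective hfix)
  · exact hq ((S.M e').injective ((S.M e').injective hfix))

/-- The index of the exceptional vertex used for the `e`-th transposition. -/
def pos (e : ℕ) : ℕ := 2 * k * (e + 1) + S.q e

/-- `y` is the index of an exceptional vertex. -/
def IsPos (y : ℕ) : Prop := ∃ e < S.E, y = S.pos e

theorem pos_add_le {e e' : ℕ} (hee : e < e') (he' : e' < S.E) :
    S.pos e + 2 * k ≤ S.pos e' := by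
  have hq : (S.q e : ℕ) ≤ S.q e' := S.q_mono hee.le he'
  have : 2 * k * (e + 1 + 1) ≤ 2 * k * (e' + 1) := Nat.mul_le_mul_left _ (by omega)
  rw [Nat.mul_succ] at this
  unfold pos
  omega

theorem pos_lt {e s : ℕ} (he : e < S.E) (hk : 2 ≤ k) (hs : k * (2 * k - 1) ≤ s) :
    S.pos e + k ≤ k + s := by
  have hE := S.E_lt (by omega)
  have hq := (S.q e).isLt
  obtain ⟨n, rfl⟩ : ∃ n, k = n + 2 := ⟨k - 2, by omega⟩
  have h1 : 2 * (n + 2) * (e + 1) ≤ 2 * (n + 2) * (n + 1) := Nat.mul_le_mul_left _ (by omega)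
  have h2 : (n + 2) * (2 * (n + 2) - 1) = 2 * (n + 2) * (n + 1) + (n + 2) := by
    rw [show 2 * (n + 2) - 1 = 2 * n + 3 by omega]; ring
  unfold pos
  omega

theorem two_mul_le_pos (e : ℕ) : 2 * k ≤ S.pos e := by
  have : 2 * k * 1 ≤ 2 * k * (e + 1) := Nat.mul_le_mul_left _ (by omega)
  unfold pos
  omega

variable [NeZero k]

/-- The class index prescribed for the vertex at index `y`. -/
def lab (y : ℕ) : Fin k := S.M (y / (2 * k)) (Fin.ofNat k y)

theorem lab_eq {e y : ℕ} (h₁ : 2 * k * e ≤ y) (h₂ : y < 2 * k * (e + 1) + k)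
    (h₃ : e < S.E → y < S.pos e) : S.lab y = S.M e (Fin.ofNat k y) := by
  have hk : 0 < k := Nat.pos_of_neZero k
  rcases lt_or_ge y (2 * k * (e + 1)) with h | h
  · have : y / (2 * k) = e := Nat.div_eq_of_lt_le (by rwa [mul_comm]) (by rwa [mul_comm])
    rw [lab, this]
  · have hd : y / (2 * k) = e + 1 := by
      refine Nat.div_eq_of_lt_le (by rwa [mul_comm]) ?_
      rw [mul_comm, Nat.mul_succ (2 * k) (e + 1)]
      omega
    rw [lab, hd]
    rcases lt_or_ge e S.E with he | he
    · have hy : Fin.ofNat k y < S.q e := by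
        have hlt := h₃ he
        unfold pos at hlt
        have hmod : y % k = y - 2 * k * (e + 1) := by
          conv_lhs => rw [← Nat.sub_add_cancel h, mul_comm 2 k, mul_assoc, Nat.add_mul_mod_self_left]
          rw [← mul_assoc, mul_comm k 2]
          exact Nat.mod_eq_of_lt (by omega)
        rw [Fin.lt_def, Fin.val_ofNat, hmod]
        omega
      rw [S.fixed_succ (S.below e he _ hy), S.below e he _ hy]
    · rw [S.final e he, S.final (e + 1) (by omega)]

theorem exists_lab_window {y₀ : ℕ} (h : ∀ y, y₀ ≤ y → y < y₀ + k → ¬ S.IsPos y) :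
    ∃ e, ∀ y, y₀ ≤ y → y < y₀ + k → S.lab y = S.M e (Fin.ofNat k y) := by
  have hk : 0 < k := Nat.pos_of_neZero k
  have hd := Nat.div_add_mod y₀ (2 * k)
  have hm := Nat.mod_lt y₀ (show 0 < 2 * k by omega)
  refine ⟨y₀ / (2 * k), fun y h₁ h₂ => S.lab_eq (by omega) (by rw [Nat.mul_succ]; omega)
    fun he => ?_⟩
  by_contra hy
  refine h (S.pos (y₀ / (2 * k))) ?_ (by omega) ⟨_, he, rfl⟩
  unfold pos
  rw [Nat.mul_succ]
  omega

theorem lab_before {e y : ℕ} (h₁ : S.pos e < y + k) (h₂ : y < S.pos e) :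
    S.lab y = S.M e (Fin.ofNat k y) := by
  have hq := (S.q e).isLt
  have h := h₁
  unfold pos at h
  rw [Nat.mul_succ] at h
  refine S.lab_eq (by omega) ?_ fun _ => h₂
  have h := h₂
  unfold pos at h
  omega

theorem lab_after {e y : ℕ} (h₁ : S.pos e < y) (h₂ : y < S.pos e + k) :
    S.lab y = S.M (e + 1) (Fin.ofNat k y) := by
  have hq := (S.q e).isLt
  unfold pos at h₁ h₂
  refine S.lab_eq (by omega) (by rw [Nat.mul_succ _ (e + 1)]; omega) fun _ => ?_
  unfold pos
  rw [Nat.mul_succ _ (e + 1)]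
  omega

theorem lab_start {y : ℕ} (hy : y < 2 * k) : S.lab y = μ (Fin.ofNat k y) := by
  rw [lab, Nat.div_eq_of_lt hy, S.init]

theorem lab_end {s y : ℕ} (hk : 2 ≤ k) (hs : k * (2 * k - 1) ≤ s)
    (hy : k * (s / k + 1) ≤ y) : S.lab y = Fin.ofNat k y := by
  have hE := S.E_lt (by omega)
  have h1 : 2 * k - 1 ≤ s / k := (Nat.le_div_iff_mul_le (by omega)).mpr (by rwa [mul_comm])
  have h2 : k * (2 * S.E) ≤ k * (s / k + 1) := Nat.mul_le_mul_left _ (by omega)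
  have h3 : S.E ≤ y / (2 * k) := by
    rw [Nat.le_div_iff_mul_le (by omega)]
    calc S.E * (2 * k) = k * (2 * S.E) := by ring
      _ ≤ y := h2.trans hy
  rw [lab, S.final _ h3]
  rfl

theorem lab_injOn_period {y y' : ℕ} (h : y / k = y' / k) (hl : S.lab y = S.lab y') : y = y' := by
  unfold lab at hl
  rw [mul_comm 2 k, ← Nat.div_div_eq_div_mul, ← Nat.div_div_eq_div_mul, h,
    (S.M _).injective.eq_iff, Fin.ext_iff, Fin.val_ofNat, Fin.val_ofNat] at hl
  rw [← Nat.div_add_mod y k, ← Nat.div_add_mod y' k, h, hl]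

theorem lab_ne_of_period {e y : ℕ} (he : e < S.E) (hy : ¬ S.IsPos y)
    (h : y / k = 2 * (e + 1)) : S.lab y ≠ S.M (e + 1) (S.q e) := by
  unfold lab
  rw [mul_comm 2 k, ← Nat.div_div_eq_div_mul, h, Nat.mul_div_cancel_left _ (by omega)]
  intro hl
  rw [(S.M _).injective.eq_iff, Fin.ext_iff, Fin.val_ofNat] at hl
  refine hy ⟨e, he, ?_⟩
  rw [← Nat.div_add_mod y k, h, hl, pos]
  ring

open Classical in
/-- The indices in the window of length `s` after the first period that carry label `x`
and are not exceptional. -/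
noncomputable def labIndices (s : ℕ) (x : Fin k) : Finset ℕ :=
  (Finset.Ico k (k + s)).filter fun y => ¬ S.IsPos y ∧ S.lab y = x

theorem mem_labIndices {s y : ℕ} {x : Fin k} : y ∈ S.labIndices s x ↔
    (k ≤ y ∧ y < k + s) ∧ ¬ S.IsPos y ∧ S.lab y = x := by
  simp [labIndices]

theorem labIndices_injOn (s : ℕ) (x : Fin k) :
    Set.InjOn (fun y => y / k) (S.labIndices s x) := by
  intro y hy y' hy' h
  exact S.lab_injOn_period h ((S.mem_labIndices.mp hy).2.2.trans (S.mem_labIndices.mp hy').2.2.symm)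

theorem div_mem_Icc {s y : ℕ} (h₁ : k ≤ y) (h₂ : y < k + s) :
    y / k ∈ Finset.Icc 1 (s / k + 1) := by
  have hk : 0 < k := Nat.pos_of_neZero k
  rw [Finset.mem_Icc, Nat.le_div_iff_mul_le hk, ← Nat.add_div_right s hk]
  exact ⟨by omega, Nat.div_le_div_right (by omega)⟩

theorem card_labIndices_le (s : ℕ) (x : Fin k) : (S.labIndices s x).card ≤ s / k + 1 := by
  have := Finset.card_le_card_of_injOn (t := Finset.Icc 1 (s / k + 1)) (fun y => y / k)
    (fun y hy => by
      obtain ⟨⟨h₁, h₂⟩, -⟩ := S.mem_labIndices.mp hy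
      exact div_mem_Icc h₁ h₂) (S.labIndices_injOn s x)
  simpa using this

theorem le_card_labIndices (s : ℕ) (x : Fin k) : s / k - 1 ≤ (S.labIndices s x).card := by
  have hk : 0 < k := Nat.pos_of_neZero k
  obtain ⟨n₀, hn₀⟩ : ∃ n₀, ∀ e < S.E, S.M (e + 1) (S.q e) = x → n₀ = 2 * (e + 1) := by
    by_cases h : ∃ e < S.E, S.M (e + 1) (S.q e) = x
    · obtain ⟨e, he, hx⟩ := h
      exact ⟨2 * (e + 1), fun e' he' hx' => by rw [S.delay_unique he he' hx hx']⟩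
    · exact ⟨0, fun e he hx => absurd ⟨e, he, hx⟩ h⟩
  have hsub : (Finset.Icc 1 (s / k)).erase n₀ ⊆ (S.labIndices s x).image fun y => y / k := by
    intro n hn
    obtain ⟨hne, hn⟩ := Finset.mem_erase.mp hn
    obtain ⟨h1, h2⟩ := Finset.mem_Icc.mp hn
    set z := (S.M (n / 2)).symm x with hz
    have hdiv : (k * n + z) / k = n := by
      rw [Nat.mul_add_div hk, Nat.div_eq_of_lt z.isLt, add_zero]
    have hof : Fin.ofNat k (k * n + z) = z := by
      ext; simp [Nat.mod_eq_of_lt z.isLt]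
    have hlab : S.lab (k * n + z) = x := by
      rw [lab, mul_comm 2 k, ← Nat.div_div_eq_div_mul, hdiv, hof, hz, Equiv.apply_symm_apply]
    refine Finset.mem_image.mpr ⟨k * n + z, S.mem_labIndices.mpr ⟨⟨?_, ?_⟩, ?_, hlab⟩, hdiv⟩
    · have := Nat.mul_le_mul_left k h1
      omega
    · have h3 := Nat.mul_le_mul_left k h2
      have h4 := Nat.mul_div_le s k
      have := z.isLt
      omega
    · rintro ⟨e, he, hp⟩
      have hpd : (k * n + z) = k * (2 * (e + 1)) + S.q e := by rw [hp, pos]; ring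
      have hn2 : n = 2 * (e + 1) := by
        rw [← hdiv, hpd, Nat.mul_add_div hk, Nat.div_eq_of_lt (S.q e).isLt, add_zero]
      refine hne (Eq.trans ?_ (hn₀ e he ?_).symm)
      · exact hn2
      · rw [← hlab, lab, mul_comm 2 k, ← Nat.div_div_eq_div_mul, hdiv, hof, hn2,
          Nat.mul_div_cancel_left _ (by omega)]
        congr 1
        ext
        rw [hn2] at hpd
        omega
  have h1 := Finset.card_le_card hsub
  have h2 := Finset.pred_card_le_card_erase (s := Finset.Icc 1 (s / k)) (a := n₀)
  have h3 := Finset.card_image_le (s := S.labIndices s x) (f := fun y => y / k)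
  simp only [Nat.card_Icc] at h2
  omega

theorem card_labIndices_le_of_delay {s : ℕ} {x : Fin k} (hk : 2 ≤ k)
    (hs : k * (2 * k - 1) ≤ s) (h : (x : ℕ) < s % k → ∃ e < S.E, S.M (e + 1) (S.q e) = x) :
    (S.labIndices s x).card ≤ s / k := by
  obtain ⟨n₀, hn₀, hne⟩ : ∃ n₀ ∈ Finset.Icc 1 (s / k + 1),
      ∀ y ∈ S.labIndices s x, y / k ≠ n₀ := by
    rcases lt_or_ge (x : ℕ) (s % k) with hx | hx
    · obtain ⟨e, he, hex⟩ := h hx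
      refine ⟨2 * (e + 1), ?_, fun y hy hyn => ?_⟩
      · have h1 : 2 * k - 1 ≤ s / k :=
          (Nat.le_div_iff_mul_le (by omega)).mpr (by rwa [mul_comm])
        have := S.E_lt (by omega)
        rw [Finset.mem_Icc]
        omega
      · obtain ⟨-, hp, hl⟩ := S.mem_labIndices.mp hy
        exact S.lab_ne_of_period he hp hyn (hl.trans hex.symm)
    · refine ⟨s / k + 1, by simp, fun y hy hyn => ?_⟩
      obtain ⟨⟨-, hy2⟩, -, hl⟩ := S.mem_labIndices.mp hy
      have hd := Nat.div_add_mod y k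
      have hd' := Nat.div_add_mod s k
      rw [hyn] at hd
      rw [S.lab_end hk hs (by omega)] at hl
      have : y % k = x := by rw [← hl, Fin.val_ofNat]
      rw [Nat.mul_succ] at hd
      omega
  have := Finset.card_le_card_of_injOn (t := (Finset.Icc 1 (s / k + 1)).erase n₀)
    (fun y => y / k) (fun y hy => by
      obtain ⟨⟨h₁, h₂⟩, -⟩ := S.mem_labIndices.mp hy
      exact Finset.mem_erase.mpr ⟨hne y hy, div_mem_Icc h₁ h₂⟩) (S.labIndices_injOn s x)
  rw [Finset.card_erase_of_mem hn₀] at this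
  simpa using this

end SwapSort

theorem toFinset_take_drop {V : Type} [DecidableEq V] {k i : ℕ} {l : List V} {u : ℕ → V}
    (h : ∀ j < k, l[i + j]? = some (u j)) :
    ((l.drop i).take k).toFinset = (Finset.range k).image u := by
  have : (l.drop i).take k = (List.range k).map u := by
    refine List.ext_getElem? fun j => ?_
    rcases lt_or_ge j k with hj | hj
    · rw [List.getElem?_take_of_lt hj, List.getElem?_drop, h j hj]
      simp [hj]
    · rw [List.getElem?_take_eq_none hj]
      simp [hj]
  rw [this]
  ext v
  simp

theorem exists_getElem?_eq {V : Type} {l : List V} (hl : l ≠ []) :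
    ∃ u : ℕ → V, ∀ m < l.length, l[m]? = some (u m) :=
  ⟨fun m => l.getD m (l.head hl), fun m hm => by simp [hm]⟩

theorem cyc_val {k : ℕ} (j : Fin k) : (cyc k j : ℕ) = (j + 1) % k := by
  have := j.neZero
  rw [cyc, finRotate_apply, Fin.val_add, Fin.val_one', Nat.add_mod_mod]

theorem exists_injOn_extend {ι V : Type} [DecidableEq ι] [DecidableEq V] {Y D : Finset ι}
    {A : Finset V} {g : ι → V} (hcard : Y.card ≤ A.card) (hD : D ⊆ Y) (hg : Set.InjOn g D)
    (hgA : ∀ y ∈ D, g y ∈ A) :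
    ∃ f : Y → V, (∀ y (hy : y ∈ Y), y ∈ D → f ⟨y, hy⟩ = g y) ∧ (∀ y, f y ∈ A) ∧
      Function.Injective f := by
  have himg : D.image g ⊆ A := Finset.image_subset_iff.mpr hgA
  have hle : (D.image g).card ≤ Y.card := Finset.card_image_le.trans (Finset.card_le_card hD)
  obtain ⟨t, ht₁, ht₂, ht₃⟩ := Finset.exists_subsuperset_card_eq himg hle hcard
  obtain ⟨f, hf⟩ := Finset.exists_equiv_extend_of_card_eq (α := Y) (t := t)
    (s := Finset.univ.filter fun y : Y => (y : ι) ∈ D) (f := fun y => g y)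
    (by simpa using ht₃.symm)
    (fun v hv => by
      obtain ⟨y, hy, rfl⟩ := Finset.mem_image.mp hv
      exact ht₁ (Finset.mem_image_of_mem g (by simpa using hy)))
    (fun y hy y' hy' h => Subtype.ext (hg (by simpa using hy) (by simpa using hy') h))
  refine ⟨fun y => f y, fun y hy hyD => hf ⟨y, hy⟩ (by simpa using hyD), fun y => ht₂ (f y).2,
    fun y y' h => f.injective (Subtype.ext h)⟩

namespace SwapSort

variable {k : ℕ} {μ : Equiv.Perm (Fin k)} (S : SwapSort k μ) (ψ : Equiv.Perm (Fin k))

/-- The gadget vertex set used for the `e`-th transposition. -/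
def gadgetSet {V : Type} (W : Fin k → Fin k → Finset V) (e : ℕ) : Finset V :=
  W (ψ (S.M e (S.q e))) (ψ (S.M (e + 1) (S.q e)))

variable {V : Type} [DecidableEq V]

theorem disjoint_gadgetSet {E : Finset (Finset V)} {Vc : Fin k → Finset V}
    {G : SimpleGraph (Fin k)} {X : Finset V} {W : Fin k → Fin k → Finset V}
    (hW : IsGadget k E Vc G X W)
    (hG : ∀ i j, G.Adj i j ↔
      ∃ e < S.E, s(i, j) = s(ψ (S.M e (S.q e)), ψ (S.M (e + 1) (S.q e))))
    {e e' : ℕ} (he : e < S.E) (he' : e' < S.E) (hne : e ≠ e') :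
    Disjoint (S.gadgetSet ψ W e) (S.gadgetSet ψ W e') := by
  refine hW.2.2 _ _ _ _ ((hG _ _).mpr ⟨e, he, rfl⟩) ((hG _ _).mpr ⟨e', he', rfl⟩) ?_
  rcases lt_or_gt_of_ne hne with h | h
  · exact S.edge_ne ψ h he'
  · exact (S.edge_ne ψ h he).symm

variable [NeZero k]

theorem exists_block {E : Finset (Finset V)} {Vc : Fin k → Finset V}
    {G : SimpleGraph (Fin k)} {X : Finset V} {W : Fin k → Fin k → Finset V}
    (hW : IsGadget k E Vc G X W)
    (hG : ∀ i j, G.Adj i j ↔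
      ∃ e < S.E, s(i, j) = s(ψ (S.M e (S.q e)), ψ (S.M (e + 1) (S.q e))))
    (e : ℕ) (he : e < S.E) :
    ∃ u : ℕ → V, Set.InjOn u {y | S.pos e < y + k ∧ y < S.pos e + k} ∧
      (∀ y, S.pos e < y + k → y < S.pos e + k → u y ∈ S.gadgetSet ψ W e) ∧
      (∀ v ∈ S.gadgetSet ψ W e, ∃ y, S.pos e < y + k ∧ y < S.pos e + k ∧ u y = v) ∧
      (∀ y₀, S.pos e < y₀ + k → y₀ ≤ S.pos e →
        (Finset.range k).image (fun j => u (y₀ + j)) ∈ E) ∧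
      (∀ y, S.pos e < y + k → y < S.pos e + k → y ≠ S.pos e → u y ∈ Vc (ψ (S.lab y))) ∧
      S.gadgetSet ψ W e \ Finset.univ.biUnion Vc = {u (S.pos e)} := by
  have hk : 0 < k := Nat.pos_of_neZero k
  have hadj := (hG (ψ (S.M e (S.q e))) (ψ (S.M (e + 1) (S.q e)))).mpr ⟨e, he, rfl⟩
  obtain ⟨hcard, hout, -, -, hpath⟩ := hW.2.1 _ _ hadj
  obtain ⟨Q, ⟨hnd, hQE⟩, hQW, ⟨-, hst⟩, ⟨-, hen⟩⟩ :=
    hpath ((Equiv.addLeft (S.q e)).trans ((S.M e).trans ψ))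
      ⟨0, rfl, Or.inl (by simp)⟩
  have hlen : Q.length = 2 * k - 1 := by
    rw [← hcard, ← hQW, List.toFinset_card_of_nodup hnd]
  obtain ⟨u, hu⟩ := exists_getElem?_eq (l := Q) (by rintro rfl; simp at hlen; omega)
  have hpos := S.two_mul_le_pos e
  have hmem : ∀ y, S.pos e < y + k → y < S.pos e + k →
      u (y + k - 1 - S.pos e) ∈ S.gadgetSet ψ W e := by
    intro y h₁ h₂
    have := List.mem_of_getElem? (hu (y + k - 1 - S.pos e) (by omega))
    rw [gadgetSet, ← hQW]
    simpa using this
  have hsurj : ∀ v ∈ S.gadgetSet ψ W e,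
      ∃ y, S.pos e < y + k ∧ y < S.pos e + k ∧ u (y + k - 1 - S.pos e) = v := by
    intro v hv
    rw [gadgetSet, ← hQW, List.mem_toFinset] at hv
    obtain ⟨m, hm, rfl⟩ := List.getElem_of_mem hv
    refine ⟨m + S.pos e + 1 - k, by omega, by omega, ?_⟩
    have h1 := hu m hm
    rw [List.getElem?_eq_getElem hm] at h1
    rw [show m + S.pos e + 1 - k + k - 1 - S.pos e = m by omega]
    exact (Option.some.inj h1).symm
  have hof : ∀ y d : ℕ, S.pos e + d = y ∨ S.pos e + d = y + k →
      Fin.ofNat k y = S.q e + Fin.ofNat k d := by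
    intro y d hd
    have h1 : (y : ℕ) % k = (S.pos e + d) % k := by
      rcases hd with rfl | hd
      · rfl
      · rw [hd, Nat.add_mod_right]
    ext
    rw [Fin.val_ofNat, h1, Fin.val_add, Fin.val_ofNat, Nat.add_mod_mod, pos,
      show 2 * k * (e + 1) + S.q e + d = S.q e + d + k * (2 * (e + 1)) by ring,
      Nat.add_mul_mod_self_left]
  have hclass : ∀ y, S.pos e < y + k → y < S.pos e + k → y ≠ S.pos e →
      u (y + k - 1 - S.pos e) ∈ Vc (ψ (S.lab y)) := by
    intro y h₁ h₂ hne
    rcases lt_or_gt_of_ne hne with hlt | hlt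
    · rw [S.lab_before h₁ hlt, hof y (y + k - S.pos e) (Or.inr (by omega))]
      have h1 := hst ⟨y + k - 1 - S.pos e, by omega⟩ (by simp only; omega) _
        (hu _ (by simp only; omega))
      have h2 : cyc k ⟨y + k - 1 - S.pos e, by omega⟩ = Fin.ofNat k (y + k - S.pos e) := by
        ext
        rw [cyc_val, Fin.val_ofNat]
        congr 1
        simp only
        omega
      rw [Equiv.Perm.mul_apply, h2] at h1
      exact h1
    · rw [S.lab_after hlt h₂, hof y (y - S.pos e) (Or.inl (by omega))]
      have h1 := hen ⟨y - S.pos e, by omega⟩ (by simp only; omega) (u (y + k - 1 - S.pos e))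
        (by
          rw [Option.mem_def, ← hu _ (by omega)]
          congr 1
          simp only
          omega)
      have h2 : (⟨y - S.pos e, by omega⟩ : Fin k) = Fin.ofNat k (y - S.pos e) := by
        ext
        rw [Fin.val_ofNat, Nat.mod_eq_of_lt (by omega)]
      rw [h2, Equiv.Perm.mul_apply] at h1
      convert h1 using 2
      rw [S.step_left he, S.step e he]
      exact ((S.M e).trans ψ).injective.map_swap _ _ _
  refine ⟨fun y => u (y + k - 1 - S.pos e), ?_, hmem, hsurj, ?_, hclass, ?_⟩
  · rintro y ⟨h₁, h₂⟩ y' ⟨h₁', h₂'⟩ h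
    have h3 := hu (y + k - 1 - S.pos e) (by omega)
    have h4 := hu (y' + k - 1 - S.pos e) (by omega)
    have := (List.getElem?_inj (by omega) hnd).mp (h3.trans ((congrArg some h).trans h4.symm))
    omega
  · intro y₀ h₁ h₂
    have h1 := hQE (y₀ + k - 1 - S.pos e) (by omega)
    rwa [toFinset_take_drop (u := fun j => u (y₀ + j + k - 1 - S.pos e)) fun j hj => by
      rw [← hu _ (by omega)]
      congr 1
      omega] at h1
  · obtain ⟨v, hv⟩ := Finset.card_eq_one.mp hout
    have hv' : v ∈ S.gadgetSet ψ W e \ Finset.univ.biUnion Vc := by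
      rw [gadgetSet, hv]; simp
    obtain ⟨hv₁, hv₂⟩ := Finset.mem_sdiff.mp hv'
    obtain ⟨y, h₁, h₂, rfl⟩ := hsurj v hv₁
    have hy : y = S.pos e := by
      by_contra hne
      exact hv₂ (Finset.mem_biUnion.mpr ⟨_, Finset.mem_univ _, hclass y h₁ h₂ hne⟩)
    subst hy
    exact hv

theorem exists_assignment {E : Finset (Finset V)} {Vc : Fin k → Finset V}
    {G : SimpleGraph (Fin k)} {X : Finset V} {W : Fin k → Fin k → Finset V} {s : ℕ}
    (hVc : IsCompletePartite k E Vc)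
    (hW : IsGadget k E Vc G X W)
    (hG : ∀ i j, G.Adj i j ↔
      ∃ e < S.E, s(i, j) = s(ψ (S.M e (S.q e)), ψ (S.M (e + 1) (S.q e))))
    (hroom : ∀ i, s / k + 1 ≤ (Vc i \ X).card) :
    ∃ f : ℕ → V, (∀ y, k ≤ y → y < k + s → f y ∉ X) ∧
      Set.InjOn f {y | k ≤ y ∧ y < k + s} ∧
      (∀ y, k ≤ y → y < k + s → ¬ S.IsPos y → f y ∈ Vc (ψ (S.lab y))) ∧
      (∀ e < S.E, ∀ y₀, S.pos e < y₀ + k → y₀ ≤ S.pos e →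
        (Finset.range k).image (fun j => f (y₀ + j)) ∈ E) ∧
      ∀ e < S.E, S.gadgetSet ψ W e \ Finset.univ.biUnion Vc = {f (S.pos e)} := by
  have hk : 0 < k := Nat.pos_of_neZero k
  choose u huinj humem husurj huE huVc huout using S.exists_block ψ hW hG
  have hdisj := fun e e' => S.disjoint_gadgetSet ψ hW hG (e := e) (e' := e')
  obtain ⟨v₀, -⟩ := hVc.1 0
  have huniq : ∀ e < S.E, ∀ e' < S.E, ∀ y, S.pos e < y + k → y < S.pos e + k →
      S.pos e' < y + k → y < S.pos e' + k → e = e' := by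
    intro e he e' he' y h₁ h₂ h₃ h₄
    rcases lt_trichotomy e e' with h | h | h
    · have := S.pos_add_le h he'
      omega
    · exact h
    · have := S.pos_add_le h he
      omega
  have hex : ∀ y, ∃ v, ∀ e (he : e < S.E), S.pos e < y + k → y < S.pos e + k → v = u e he y := by
    intro y
    by_cases h : ∃ e, ∃ _ : e < S.E, S.pos e < y + k ∧ y < S.pos e + k
    · obtain ⟨e, he, h₁, h₂⟩ := h
      refine ⟨u e he y, fun e' he' h₃ h₄ => ?_⟩
      obtain rfl := huniq e he e' he' y h₁ h₂ h₃ h₄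
      rfl
    · exact ⟨v₀, fun e he h₁ h₂ => absurd ⟨e, he, h₁, h₂⟩ h⟩
  choose g hg using hex
  have hginj : ∀ e < S.E, ∀ e' < S.E, ∀ y y', S.pos e < y + k → y < S.pos e + k →
      S.pos e' < y' + k → y' < S.pos e' + k → g y = g y' → y = y' := by
    intro e he e' he' y y' h₁ h₂ h₃ h₄ h
    rw [hg y e he h₁ h₂, hg y' e' he' h₃ h₄] at h
    by_cases hee : e = e'
    · subst hee
      exact huinj e he ⟨h₁, h₂⟩ ⟨h₃, h₄⟩ h
    · exact absurd h (Finset.disjoint_iff_ne.mp (hdisj e e' he he' hee) _ (humem e he y h₁ h₂) _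
        (humem e' he' y' h₃ h₄))
  have hgX : ∀ e (he : e < S.E) y, S.pos e < y + k → y < S.pos e + k → g y ∉ X := by
    intro e he y h₁ h₂
    rw [hg y e he h₁ h₂]
    exact Finset.disjoint_left.mp (hW.2.1 _ _ ((hG _ _).mpr ⟨e, he, rfl⟩)).2.2.1
      (humem e he y h₁ h₂)
  classical
  have hfill : ∀ x : Fin k, ∃ F : S.labIndices s x → V,
      (∀ y (hy : y ∈ S.labIndices s x),
        y ∈ (S.labIndices s x).filter
          (fun y => ∃ e < S.E, S.pos e < y + k ∧ y < S.pos e + k) → F ⟨y, hy⟩ = g y) ∧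
      (∀ y, F y ∈ Vc (ψ x) \ X) ∧ Function.Injective F := by
    intro x
    refine exists_injOn_extend ((S.card_labIndices_le s x).trans (hroom _))
      (Finset.filter_subset _ _) ?_ ?_
    · intro y hy y' hy' h
      obtain ⟨-, e, he, h₁, h₂⟩ := Finset.mem_filter.mp hy
      obtain ⟨-, e', he', h₃, h₄⟩ := Finset.mem_filter.mp hy'
      exact hginj e he e' he' y y' h₁ h₂ h₃ h₄ h
    · intro y hy
      obtain ⟨hy, e, he, h₁, h₂⟩ := Finset.mem_filter.mp hy
      obtain ⟨-, hpos, hlab⟩ := S.mem_labIndices.mp hy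
      refine Finset.mem_sdiff.mpr ⟨?_, hgX e he y h₁ h₂⟩
      rw [hg y e he h₁ h₂, ← hlab]
      exact huVc e he y h₁ h₂ fun h => hpos ⟨e, he, h⟩
  choose F hFg hFA hFinj using hfill
  let f : ℕ → V := fun y => if h : y ∈ S.labIndices s (S.lab y) then F (S.lab y) ⟨y, h⟩ else g y
  have hfpos : ∀ e < S.E, f (S.pos e) = g (S.pos e) := fun e he =>
    dif_neg fun h => (S.mem_labIndices.mp h).2.1 ⟨e, he, rfl⟩
  have hffree : ∀ y, k ≤ y → y < k + s → ¬ S.IsPos y →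
      ∃ h : y ∈ S.labIndices s (S.lab y), f y = F (S.lab y) ⟨y, h⟩ := fun y h₁ h₂ h₃ =>
    have h := S.mem_labIndices.mpr ⟨⟨h₁, h₂⟩, h₃, rfl⟩
    ⟨h, dif_pos h⟩
  have hfblock : ∀ e < S.E, ∀ y, S.pos e < y + k → y < S.pos e + k → f y = g y := by
    intro e he y h₁ h₂
    by_cases h : y ∈ S.labIndices s (S.lab y)
    · have : f y = F (S.lab y) ⟨y, h⟩ := dif_pos h
      rw [this]
      exact hFg _ y h (Finset.mem_filter.mpr ⟨h, e, he, h₁, h₂⟩)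
    · exact dif_neg h
  have hfVc : ∀ y, k ≤ y → y < k + s → ¬ S.IsPos y → f y ∈ Vc (ψ (S.lab y)) \ X := by
    intro y h₁ h₂ h₃
    obtain ⟨h, hf⟩ := hffree y h₁ h₂ h₃
    rw [hf]
    exact hFA _ _
  have hout : ∀ e < S.E, S.gadgetSet ψ W e \ Finset.univ.biUnion Vc = {f (S.pos e)} := by
    intro e he
    rw [hfpos e he, hg _ e he (by omega) (by omega)]
    exact huout e he
  have hposVc : ∀ e < S.E, ∀ i, f (S.pos e) ∉ Vc i := by
    intro e he i hi
    have h : f (S.pos e) ∈ S.gadgetSet ψ W e \ Finset.univ.biUnion Vc := by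
      rw [hout e he]; simp
    exact (Finset.mem_sdiff.mp h).2 (Finset.mem_biUnion.mpr ⟨i, Finset.mem_univ _, hi⟩)
  refine ⟨f, fun y h₁ h₂ => ?_, ?_,
    fun y h₁ h₂ h₃ => (Finset.mem_sdiff.mp (hfVc y h₁ h₂ h₃)).1, ?_, hout⟩
  · by_cases hy : S.IsPos y
    · obtain ⟨e, he, rfl⟩ := hy
      rw [hfpos e he]
      exact hgX e he _ (by omega) (by omega)
    · exact (Finset.mem_sdiff.mp (hfVc y h₁ h₂ hy)).2
  · rintro y ⟨h₁, h₂⟩ y' ⟨h₃, h₄⟩ h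
    by_cases hy : S.IsPos y <;> by_cases hy' : S.IsPos y'
    · obtain ⟨e, he, rfl⟩ := hy
      obtain ⟨e', he', rfl⟩ := hy'
      rw [hfpos e he, hfpos e' he'] at h
      exact hginj e he e' he' _ _ (by omega) (by omega) (by omega) (by omega) h
    · obtain ⟨e, he, rfl⟩ := hy
      exact absurd (h ▸ (Finset.mem_sdiff.mp (hfVc y' h₃ h₄ hy')).1) (hposVc e he _)
    · obtain ⟨e, he, rfl⟩ := hy'
      exact absurd (h ▸ (Finset.mem_sdiff.mp (hfVc y h₁ h₂ hy)).1) (hposVc e he _)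
    · have hm := (Finset.mem_sdiff.mp (hfVc y h₁ h₂ hy)).1
      have hm' := (Finset.mem_sdiff.mp (hfVc y' h₃ h₄ hy')).1
      have hlab : S.lab y = S.lab y' := by
        by_contra hne
        exact Finset.disjoint_left.mp (hVc.2.1 _ _ fun h => hne (ψ.injective h)) hm (h ▸ hm')
      obtain ⟨hl, hf⟩ := hffree y h₁ h₂ hy
      obtain ⟨hl', hf'⟩ := hffree y' h₃ h₄ hy'
      rw [hf, hf'] at h
      have key : ∀ x (hx : S.lab y' = x) (hm : y' ∈ S.labIndices s x),
          F (S.lab y') ⟨y', hl'⟩ = F x ⟨y', hm⟩ := by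
        rintro x rfl _
        rfl
      rw [key _ hlab.symm (hlab ▸ hl')] at h
      exact congrArg Subtype.val (hFinj _ h)
  · intro e he y₀ h₁ h₂
    have := huE e he y₀ h₁ h₂
    rwa [Finset.image_congr (g := fun j => f (y₀ + j)) fun j hj => ?_] at this
    have hj' : j < k := by simpa using hj
    simp only
    rw [hfblock e he _ (by omega) (by omega), hg _ e he (by omega) (by omega)]

end SwapSort

/-- for all `σ, π` and `0 ≤ r < k` there is a union-of-paths graph `G(σ,π,r)`
on `[k]` such that any tight path with start of type `σ` and end of type `π`, equipped with a
`G`-gadget and enough room in the classes, extends to a tight cycle on `|V(P)| + s` vertices,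
for any `s ≥ k(2k-1)` with `s ≡ r (mod k)`. -/
theorem gadget_tight_cycle (k : ℕ) (hk : 3 ≤ k) (σ π : Equiv.Perm (Fin k))
    (r : ℕ) (hr : r < k) :
    ∃ G : SimpleGraph (Fin k), IsUnionOfPaths k G ∧
      ∀ s : ℕ, k * (2 * k - 1) ≤ s → s % k = r →
      ∀ (V : Type) [Fintype V] [DecidableEq V] (E : Finset (Finset V)),
        IsKGraph k E →
        ∀ Vc : Fin k → Finset V, IsCompletePartite k E Vc →
        ∀ P : List V, IsTightPath k E P → hasStartType k Vc P σ → hasEndType k Vc P π →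
        ∀ W : Fin k → Fin k → Finset V, IsGadget k E Vc G P.toFinset W →
        (∀ i : Fin k, s / k + 1 ≤ ((Vc i) \ P.toFinset).card) →
        ∃ Q : List V, Q.length = s ∧ IsTightCycleList k E (P ++ Q) ∧
          (P ++ Q).toFinset \ (P.toFinset ∪ Finset.univ.biUnion Vc) = gadgetVerts k Vc G W ∧
          (σ = π → ∀ i j : Fin k,
            |((Vc i ∩ ((P ++ Q).toFinset \ P.toFinset)).card : ℤ) -
              ((Vc j ∩ ((P ++ Q).toFinset \ P.toFinset)).card : ℤ)| ≤ 1) := by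
  have : NeZero k := ⟨by omega⟩
  obtain ⟨ψ, hψ⟩ : ∃ ψ : Equiv.Perm (Fin k), ∀ x, ψ (x + Fin.ofNat k r) = σ x :=
    ⟨(Equiv.addRight (Fin.ofNat k r)).symm.trans σ, fun x => by simp⟩
  obtain ⟨S⟩ := SwapSort.nonempty (by omega) (π.trans ψ.symm)
  obtain ⟨G, hGp, hG⟩ := S.exists_paths_graph ψ
  refine ⟨G, hGp, ?_⟩
  rintro s hs hsr V _ _ E - Vc hVc P ⟨hPnd, hPE⟩ ⟨hPlen, hst⟩ ⟨-, hen⟩ W hW hroom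
  obtain ⟨f, hfP, hfinj, hfVc, hfE, hfout⟩ := S.exists_assignment ψ hVc hW hG hroom
  have hsk : k ≤ s := le_trans (Nat.le_mul_of_pos_right k (by omega)) hs
  have hposS : ∀ e < S.E, S.pos e + k ≤ k + s := fun e he => S.pos_lt he (by omega) hs
  have hposk := S.two_mul_le_pos
  set Q : List V := (List.range s).map fun m => f (k + m) with hQ
  have hQlen : Q.length = s := by simp [hQ]
  have hQget : ∀ m < s, Q[m]? = some (f (k + m)) := fun m hm => by simp [hQ, hm]
  have hQmem : ∀ v, v ∈ Q ↔ ∃ y, k ≤ y ∧ y < k + s ∧ f y = v := by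
    intro v
    simp only [hQ, List.mem_map, List.mem_range]
    constructor
    · rintro ⟨m, hm, rfl⟩
      exact ⟨k + m, by omega, by omega, rfl⟩
    · rintro ⟨y, h₁, h₂, rfl⟩
      exact ⟨y - k, by omega, by rw [Nat.add_sub_cancel' h₁]⟩
  have hnew : ∀ v, v ∈ (P ++ Q).toFinset \ P.toFinset ↔ ∃ y, k ≤ y ∧ y < k + s ∧ f y = v := by
    intro v
    rw [← hQmem]
    simp only [List.toFinset_append, Finset.mem_sdiff, Finset.mem_union, List.mem_toFinset]
    constructor
    · tauto
    · intro h
      refine ⟨Or.inr h, ?_⟩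
      obtain ⟨y, h₁, h₂, rfl⟩ := (hQmem v).mp h
      simpa using hfP y h₁ h₂
  have hpos_not : ∀ e < S.E, ∀ i, f (S.pos e) ∉ Vc i := by
    intro e he i hi
    have h : f (S.pos e) ∈ S.gadgetSet ψ W e \ Finset.univ.biUnion Vc := by
      rw [hfout e he]; simp
    exact (Finset.mem_sdiff.mp h).2 (Finset.mem_biUnion.mpr ⟨i, Finset.mem_univ _, hi⟩)
  refine ⟨Q, hQlen, ⟨?_, ?_⟩, ?_, ?_⟩
  · refine List.nodup_append.mpr ⟨hPnd, ?_, ?_⟩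
    · refine List.Nodup.map_on (fun m hm m' hm' h => ?_) List.nodup_range
      have h₁ := List.mem_range.mp hm
      have h₂ := List.mem_range.mp hm'
      have := hfinj (show k + m ∈ {y | k ≤ y ∧ y < k + s} from ⟨by omega, by omega⟩)
        (show k + m' ∈ {y | k ≤ y ∧ y < k + s} from ⟨by omega, by omega⟩) h
      omega
    · rintro a ha b hb rfl
      obtain ⟨y, h₁, h₂, rfl⟩ := (hQmem _).mp hb
      exact hfP y h₁ h₂ (by simpa using ha)
  · intro i hi
    obtain ⟨u, hu⟩ := exists_getElem?_eq (l := (P ++ Q) ++ (P ++ Q)) (by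
      rintro h
      simp only [List.append_eq_nil_iff] at h
      rw [h.1.2, List.length_nil] at hQlen
      omega)
    simp only [List.length_append, hQlen] at hu hi
    have huP : ∀ m < P.length, P[m]? = some (u m) := by
      intro m hm
      rw [← hu m (by omega), List.getElem?_append_left (by rw [List.length_append]; omega),
        List.getElem?_append_left hm]
    have huQ : ∀ y, k ≤ y → y < k + s → u (y + P.length - k) = f y := by
      intro y h₁ h₂
      have := hu (y + P.length - k) (by omega)
      rw [List.getElem?_append_left (by rw [List.length_append]; omega),
        List.getElem?_append_right (by omega), hQget _ (by omega)] at this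
      rw [← Option.some.inj this]
      congr 1
      omega
    have huP' : ∀ m < P.length, P[m]? = some (u (P.length + s + m)) := by
      intro m hm
      rw [← hu _ (by omega), List.getElem?_append_right (by rw [List.length_append]; omega),
        List.getElem?_append_left (by rw [List.length_append]; omega)]
      congr 1
      rw [List.length_append]
      omega
    have huVc : ∀ y, 1 ≤ y → y + 1 < 2 * k + s → ¬ S.IsPos y →
        u (y + P.length - k) ∈ Vc (ψ (S.lab y)) := by
      intro y h₁ h₂ hy
      rcases lt_or_ge y k with h₃ | h₃
      · have h := hen ⟨y, h₃⟩ (by simp only; omega) (u (y + P.length - k)) (by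
          rw [Option.mem_def, ← huP _ (by omega)]
          congr 1
          simp only
          omega)
        have hof : Fin.ofNat k y = ⟨y, h₃⟩ := by ext; simp [Nat.mod_eq_of_lt h₃]
        rw [S.lab_start (by omega), hof]
        simpa using h
      · rcases lt_or_ge y (k + s) with h₄ | h₄
        · rw [huQ y h₃ h₄]
          exact hfVc y h₃ h₄ hy
        · have h := hst ⟨y - (k + s), by omega⟩ (by simp only; omega) (u (y + P.length - k)) (by
            rw [Option.mem_def, huP' _ (by simp only; omega)]
            congr 2
            simp only
            omega)
          have hle : k * (s / k + 1) ≤ y := by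
            have := Nat.mul_div_le s k
            rw [Nat.mul_succ]
            omega
          have hof : Fin.ofNat k y = ⟨y - (k + s), by omega⟩ + Fin.ofNat k r := by
            ext
            rw [Fin.val_add, Fin.val_ofNat, Fin.val_ofNat, Nat.add_mod_mod, ← hsr, Nat.add_mod_mod]
            simp only
            conv_lhs => rw [show y = y - (k + s) + s + k by omega]
            rw [Nat.add_mod_right]
          rw [S.lab_end (by omega) hs hle, hof, hψ]
          exact h
    rcases Nat.lt_or_ge P.length (i + k) with hik | hik
    · rw [toFinset_take_drop (u := fun j => u (i + j)) fun j hj => hu _ (by omega)]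
      by_cases hw : ∃ e < S.E, i + k - P.length ≤ S.pos e ∧ S.pos e < i + k - P.length + k
      · obtain ⟨e, he, h₁, h₂⟩ := hw
        have h := hfE e he _ h₂ h₁
        rwa [Finset.image_congr (g := fun j => u (i + j)) fun j hj => ?_] at h
        have hj' : j < k := by simpa using hj
        have h₃ := hposS e he
        have h₄ := hposk e
        simp only
        rw [← huQ _ (by omega) (by omega)]
        congr 1
        omega
      · obtain ⟨e, hlab⟩ := S.exists_lab_window (y₀ := i + k - P.length) fun y h₁ h₂ hy => by
          obtain ⟨e, he, rfl⟩ := hy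
          exact hw ⟨e, he, h₁, h₂⟩
        let φ : Equiv.Perm (Fin k) :=
          (Equiv.addLeft (Fin.ofNat k (i + k - P.length))).trans ((S.M e).trans ψ)
        have hφ : ∀ j : Fin k, u (i + j) ∈ Vc (φ j) := by
          intro j
          have h := huVc (i + k - P.length + j) (by omega) (by omega) fun ⟨e, he, h⟩ =>
            hw ⟨e, he, by omega, by omega⟩
          rw [hlab _ (by omega) (by omega)] at h
          have hof : Fin.ofNat k (i + k - P.length + j) = Fin.ofNat k (i + k - P.length) + j := by
            ext
            simp [Fin.val_add]
          rwa [hof, show i + k - P.length + (j : ℕ) + P.length - k = i + j by omega] at h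
        have h := hVc.2.2 (fun c => u (i + φ.symm c)) fun c => by
          simpa using hφ (φ.symm c)
        convert h using 1
        ext v
        simp only [Finset.mem_image, Finset.mem_range, Finset.mem_univ, true_and]
        constructor
        · rintro ⟨j, hj, rfl⟩
          exact ⟨φ ⟨j, hj⟩, by simp⟩
        · rintro ⟨c, rfl⟩
          exact ⟨φ.symm c, (φ.symm c).isLt, rfl⟩
    · rw [toFinset_take_drop (u := fun j => u (i + j)) fun j hj => hu _ (by omega),
        ← toFinset_take_drop (l := P) (i := i) fun j hj => huP _ (by omega)]
      exact hPE i hik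
  · ext v
    rw [← Finset.sup_eq_union, ← sdiff_sdiff_left, Finset.mem_sdiff, hnew]
    simp only [gadgetVerts, Finset.mem_biUnion, Finset.mem_filter, Finset.mem_univ, true_and,
      Prod.exists]
    constructor
    · rintro ⟨⟨y, h₁, h₂, rfl⟩, hv⟩
      by_cases hy : S.IsPos y
      · obtain ⟨e, he, rfl⟩ := hy
        refine ⟨_, _, (hG _ _).mpr ⟨e, he, rfl⟩, ?_⟩
        have h := hfout e he
        unfold SwapSort.gadgetSet at h
        rw [h, Finset.mem_singleton]
      · exact absurd ⟨_, hfVc y h₁ h₂ hy⟩ hv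
    · rintro ⟨i, j, hadj, hv⟩
      obtain ⟨e, he, hij⟩ := (hG i j).mp hadj
      have hWe : W i j = S.gadgetSet ψ W e := by
        rcases Sym2.eq_iff.mp hij with ⟨rfl, rfl⟩ | ⟨rfl, rfl⟩
        · rfl
        · exact hW.1 _ _ hadj
      rw [hWe, hfout e he, Finset.mem_singleton] at hv
      subst hv
      have h₃ := hposS e he
      have h₄ := hposk e
      exact ⟨⟨S.pos e, by omega, by omega, rfl⟩, fun ⟨i, hi⟩ => hpos_not e he i hi⟩
  · rintro rfl
    have hcard : ∀ i, (Vc i ∩ ((P ++ Q).toFinset \ P.toFinset)).card =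
        (S.labIndices s (ψ.symm i)).card := by
      intro i
      rw [← Finset.card_image_of_injOn (f := f) (s := S.labIndices s (ψ.symm i))]
      · congr 1
        ext v
        rw [Finset.mem_inter, hnew, Finset.mem_image]
        constructor
        · rintro ⟨hv, y, h₁, h₂, rfl⟩
          have hy : ¬ S.IsPos y := by
            rintro ⟨e, he, rfl⟩
            exact hpos_not e he i hv
          refine ⟨y, S.mem_labIndices.mpr ⟨⟨h₁, h₂⟩, hy, ?_⟩, rfl⟩
          rw [Equiv.eq_symm_apply]
          by_contra hne
          exact Finset.disjoint_left.mp (hVc.2.1 _ _ hne) (hfVc y h₁ h₂ hy) hv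
        · rintro ⟨y, hy, rfl⟩
          obtain ⟨⟨h₁, h₂⟩, hp, hl⟩ := S.mem_labIndices.mp hy
          have h := hfVc y h₁ h₂ hp
          rw [hl, Equiv.apply_symm_apply] at h
          exact ⟨h, y, h₁, h₂, rfl⟩
      · intro y hy y' hy' h
        exact hfinj (S.mem_labIndices.mp hy).1 (S.mem_labIndices.mp hy').1 h
    have hbound : ∀ x, s / k - 1 ≤ (S.labIndices s x).card ∧
        (S.labIndices s x).card ≤ s / k := by
      refine fun x => ⟨S.le_card_labIndices s x,
        S.card_labIndices_le_of_delay (by omega) hs fun hx => ?_⟩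
      rw [hsr] at hx
      refine S.exists_delay (y := ⟨x + k - r, by omega⟩) ?_ ?_
      · rw [Fin.lt_def]
        simp only
        omega
      · rw [Equiv.trans_apply, Equiv.symm_apply_eq, ← hψ]
        congr 1
        ext
        rw [Fin.val_add, Fin.val_ofNat, Nat.add_mod_mod]
        simp only
        rw [show (x : ℕ) + k - r + r = x + k by omega, Nat.add_mod_right,
          Nat.mod_eq_of_lt x.isLt]
    intro i j
    rw [hcard, hcard, abs_le]
    obtain ⟨h₁, h₂⟩ := hbound (ψ.symm i)
    obtain ⟨h₃, h₄⟩ := hbound (ψ.symm j)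
    omega
end
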